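/- arXiv:2502.05501 — 2 statements merged into one kernel-verified Lean document; each statement's English description precedes it below -/
import Mathlib

section
/- For every nonzero integer k there exist a constant λ₀ > 0 and smooth functions w₁, w₂, h₁, h₂ : I → ℝ, with w₁ not identically zero, such that on I: μ( D²w₁ + (1/r)Dw₁ − ((k²+1)/r²) w₁ − (λ₀ ρ̄/μ) w₁ ) − (2μk/r²) w₂ − Dh₁ − g h₂ = 0; μ( D²w₂ + (1/r)Dw₂ − ((k²+1)/r²) w₂ − (λ₀ ρ̄/μ) w₂ ) − (2μk/r²) w₁ + (k/r) h₁ = 0; λ₀ h₂ = −w₁ Dρ̄; k w₂ = −D(r w₁); together with the boundary conditions w₁(R₁) = w₁(R₂) = 0, w₂(R₂) = 0, and Dw₂(R₁) = (1/R₁ − α/μ) w₂(R₁). -/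
open Real MeasureTheory Set

noncomputable section

/-- The right-hand side of the linear system `y' = A(t) y + F(t)`. -/
def linearField {n : ℕ} (A : ℝ → Fin n → Fin n → ℝ) (F : ℝ → Fin n → ℝ) (t : ℝ)
    (x : Fin n → ℝ) : Fin n → ℝ :=
  fun i => ∑ j, A t i j * x j + F t i

lemma norm_linearField_sub_le {n : ℕ} {A : ℝ → Fin n → Fin n → ℝ} {F : ℝ → Fin n → ℝ} {t M : ℝ}
    (hM : ∀ i j, |A t i j| ≤ M) (x y : Fin n → ℝ) :
    ‖linearField A F t x - linearField A F t y‖ ≤ n * M * ‖x - y‖ := by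
  have hM0 : 0 ≤ n * M := by
    rcases Nat.eq_zero_or_pos n with h | h
    · simp [h]
    · exact mul_nonneg n.cast_nonneg ((abs_nonneg _).trans (hM ⟨0, h⟩ ⟨0, h⟩))
  refine (pi_norm_le_iff_of_nonneg (mul_nonneg hM0 (norm_nonneg _))).2 fun i => ?_
  have h : (linearField A F t x - linearField A F t y) i = ∑ j, A t i j * (x - y) j := by
    simp [linearField, mul_sub, Finset.sum_sub_distrib]
  rw [h]
  calc ‖∑ j, A t i j * (x - y) j‖ ≤ ∑ j, ‖A t i j * (x - y) j‖ := norm_sum_le _ _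
    _ ≤ ∑ _j : Fin n, M * ‖x - y‖ := by
        refine Finset.sum_le_sum fun j _ => ?_
        rw [norm_mul]
        exact mul_le_mul (hM i j) (norm_le_pi_norm (x - y) j) (norm_nonneg _)
          ((abs_nonneg _).trans (hM i j))
    _ = n * M * ‖x - y‖ := by simp [mul_assoc]

/-- Coordinatewise truncation to `[-R, R]`. -/
def clamp {n : ℕ} (R : ℝ) (x : Fin n → ℝ) : Fin n → ℝ := fun i => max (-R) (min R (x i))

lemma norm_clamp_sub_le {n : ℕ} (R : ℝ) (x y : Fin n → ℝ) :
    ‖clamp R x - clamp R y‖ ≤ ‖x - y‖ := by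
  refine (pi_norm_le_iff_of_nonneg (norm_nonneg _)).2 fun i => ?_
  refine le_trans ?_ (norm_le_pi_norm (x - y) i)
  have h1 := abs_max_sub_max_le_max (-R) (min R (x i)) (-R) (min R (y i))
  have h2 := abs_min_sub_min_le_max R (x i) R (y i)
  rw [sub_self, abs_zero, max_eq_right (abs_nonneg (_ : ℝ))] at h1 h2
  exact h1.trans h2

lemma norm_clamp_le {n : ℕ} {R : ℝ} (hR : 0 ≤ R) (x : Fin n → ℝ) : ‖clamp R x‖ ≤ R := by
  refine (pi_norm_le_iff_of_nonneg hR).2 fun i => ?_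
  rw [norm_eq_abs, abs_le]
  exact ⟨le_max_left _ _, max_le (by linarith) (min_le_left _ _)⟩

lemma clamp_eq_self {n : ℕ} {R : ℝ} {x : Fin n → ℝ} (h : ‖x‖ ≤ R) : clamp R x = x := by
  ext i
  have := abs_le.1 ((norm_le_pi_norm x i).trans h)
  simp [clamp, min_eq_right this.2, max_eq_right this.1]

lemma clamp_zero {n : ℕ} {R : ℝ} (hR : 0 ≤ R) : clamp R (0 : Fin n → ℝ) = 0 :=
  clamp_eq_self (by simpa using hR)

lemma continuous_linearField {n : ℕ} {A : ℝ → Fin n → Fin n → ℝ} {F : ℝ → Fin n → ℝ}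
    (hA : ∀ i j, Continuous fun t => A t i j) (hF : ∀ i, Continuous fun t => F t i)
    (x : Fin n → ℝ) : Continuous fun t => linearField A F t x := by
  unfold linearField
  fun_prop

lemma exists_forall_abs_le {n : ℕ} {A : ℝ → Fin n → Fin n → ℝ}
    (hA : ∀ i j, Continuous fun t => A t i j) (a b : ℝ) :
    ∃ M, 0 ≤ M ∧ ∀ t ∈ Icc a b, ∀ i j, |A t i j| ≤ M := by
  obtain ⟨M, hM⟩ := isCompact_Icc.exists_bound_of_continuousOn
    (f := A) (s := Icc a b) (continuous_pi fun i => continuous_pi fun j => hA i j).continuousOn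
  refine ⟨max M 0, le_max_right _ _, fun t ht i j => ?_⟩
  exact ((norm_le_pi_norm (A t i) j).trans ((norm_le_pi_norm (A t) i).trans (hM t ht))).trans
    (le_max_left _ _)

lemma exists_hasDerivWithinAt_linearField {n : ℕ} {A : ℝ → Fin n → Fin n → ℝ}
    {F : ℝ → Fin n → ℝ}
    (hA : ∀ i j, Continuous fun t => A t i j) (hF : ∀ i, Continuous fun t => F t i)
    (t₀ : ℝ) (y₀ : Fin n → ℝ) {T : ℝ} (hT : 0 ≤ T) :
    ∃ y : ℝ → Fin n → ℝ, y t₀ = y₀ ∧ ∀ t ∈ Icc (t₀ - T) (t₀ + T),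
      HasDerivWithinAt y (linearField A F t (y t)) (Icc (t₀ - T) (t₀ + T)) t := by
  obtain ⟨M, hM0, hM⟩ := exists_forall_abs_le hA (t₀ - T) (t₀ + T)
  obtain ⟨ε, hε⟩ := isCompact_Icc.exists_bound_of_continuousOn
    (f := F) (s := Icc (t₀ - T) (t₀ + T)) (continuous_pi hF).continuousOn
  have ht₀ : t₀ ∈ Icc (t₀ - T) (t₀ + T) := ⟨by linarith, by linarith⟩
  have hε0 : 0 ≤ ε := (norm_nonneg _).trans (hε t₀ ht₀)
  set K : ℝ := n * M with hK
  have hK0 : 0 ≤ K := by positivity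
  set R : ℝ := gronwallBound ‖y₀‖ K ε T with hR
  have hR0 : 0 ≤ R := by
    have h := gronwallBound_mono (norm_nonneg y₀) hε0 hK0 hT
    rw [gronwallBound_x0] at h
    exact (norm_nonneg _).trans h
  have hgrow : ∀ t ∈ Icc (t₀ - T) (t₀ + T), ∀ x : Fin n → ℝ,
      ‖linearField A F t x‖ ≤ K * ‖x‖ + ε := by
    intro t ht x
    have h0 : linearField A F t 0 = F t := by ext i; simp [linearField]
    have h1 := norm_linearField_sub_le (F := F) (hM t ht) x 0
    rw [h0, sub_zero] at h1
    have h2 := hε t ht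
    have h3 := norm_le_norm_sub_add (linearField A F t x) (F t)
    linarith
  have hclamp : ∀ x : Fin n → ℝ, ‖clamp R x‖ ≤ ‖x‖ := fun x => by
    have := norm_clamp_sub_le R x 0
    rwa [clamp_zero hR0, sub_zero, sub_zero] at this
  set v : ℝ → (Fin n → ℝ) → Fin n → ℝ := fun t x => linearField A F t (clamp R x) with hv
  set L : ℝ := K * R + ε
  have hL0 : 0 ≤ L := by positivity
  have hPL : IsPicardLindelof v (⟨t₀, ht₀⟩ : Icc (t₀ - T) (t₀ + T)) y₀
      (⟨L * T, by positivity⟩) 0 ⟨L, hL0⟩ ⟨K, hK0⟩ := by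
    refine ⟨fun t ht => ?_, fun x _ => ?_, fun t ht x _ => ?_, ?_⟩
    · refine LipschitzOnWith.of_dist_le_mul fun x _ y _ => ?_
      rw [dist_eq_norm, dist_eq_norm]
      exact (norm_linearField_sub_le (hM t ht) _ _).trans
        (mul_le_mul_of_nonneg_left (norm_clamp_sub_le R x y) hK0)
    · exact (continuous_linearField hA hF (clamp R x)).continuousOn
    · refine (hgrow t ht _).trans ?_
      have := mul_le_mul_of_nonneg_left (norm_clamp_le hR0 x) hK0
      change K * _ + ε ≤ K * R + ε
      linarith
    · change L * max (t₀ + T - t₀) (t₀ - (t₀ - T)) ≤ L * T - 0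
      simp
  obtain ⟨y, hy0, hy⟩ := hPL.exists_eq_forall_mem_Icc_hasDerivWithinAt₀
  have hvgrow : ∀ t ∈ Icc (t₀ - T) (t₀ + T), ∀ x : Fin n → ℝ, ‖v t x‖ ≤ K * ‖x‖ + ε := by
    intro t ht x
    have := mul_le_mul_of_nonneg_left (hclamp x) hK0
    exact (hgrow t ht _).trans (by linarith)
  have hcont : ContinuousOn y (Icc (t₀ - T) (t₀ + T)) := fun t ht => (hy t ht).continuousWithinAt
  have hbound : ∀ t ∈ Icc (t₀ - T) (t₀ + T), ‖y t‖ ≤ R := by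
    intro t ht
    rcases le_total t₀ t with h | h
    · have hsub : Icc t₀ (t₀ + T) ⊆ Icc (t₀ - T) (t₀ + T) := Icc_subset_Icc_left (by linarith)
      have := norm_le_gronwallBound_of_norm_deriv_right_le (f := y) (f' := fun t => v t (y t))
        (δ := ‖y₀‖) (K := K) (ε := ε) (a := t₀) (b := t₀ + T) (hcont.mono hsub)
        (fun s hs => ?_) (by rw [hy0]) (fun s hs => hvgrow s (hsub (Ico_subset_Icc_self hs)) _)
        t ⟨h, ht.2⟩
      · exact this.trans (gronwallBound_mono (norm_nonneg _) hε0 hK0 (by linarith [ht.2]))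
      · exact (hy s (hsub (Ico_subset_Icc_self hs))).mono_of_mem_nhdsWithin
          (Icc_mem_nhdsGE_of_mem ⟨by linarith [hs.1], hs.2⟩)
    · have hmem : ∀ s ∈ Icc t₀ (t₀ + T), 2 * t₀ - s ∈ Icc (t₀ - T) (t₀ + T) := fun s hs =>
        ⟨by linarith [hs.2], by linarith [hs.1]⟩
      have := norm_le_gronwallBound_of_norm_deriv_right_le (f := fun s => y (2 * t₀ - s))
        (f' := fun s => -v (2 * t₀ - s) (y (2 * t₀ - s)))
        (δ := ‖y₀‖) (K := K) (ε := ε) (a := t₀) (b := t₀ + T)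
        (hcont.comp (by fun_prop) hmem)
        (fun s hs => ?_) (le_of_eq (by rw [← hy0]; congr 2; ring))
        (fun s hs => by
          rw [norm_neg]; exact hvgrow _ (hmem s (Ico_subset_Icc_self hs)) _)
        (2 * t₀ - t) ⟨by linarith, by linarith [ht.1]⟩
      · simp only [sub_sub_cancel] at this
        exact this.trans (gronwallBound_mono (norm_nonneg _) hε0 hK0 (by linarith [ht.1]))
      · have h1 := hy _ (hmem s (Ico_subset_Icc_self hs))
        have h2 : HasDerivWithinAt (fun s : ℝ => 2 * t₀ - s) (-1) (Icc (t₀) (t₀ + T)) s := by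
          simpa using ((hasDerivAt_id s).const_sub (2 * t₀)).hasDerivWithinAt
        have h3 := (h1.scomp s h2 hmem).mono_of_mem_nhdsWithin
          (Icc_mem_nhdsGE_of_mem (⟨hs.1, hs.2⟩ : s ∈ Ico t₀ (t₀ + T)))
        simpa [Function.comp_def] using h3
  refine ⟨y, hy0, fun t ht => ?_⟩
  have := hy t ht
  simp only [hv, clamp_eq_self (hbound t ht)] at this
  exact this

lemma exists_hasDerivAt_linearField {n : ℕ} {A : ℝ → Fin n → Fin n → ℝ} {F : ℝ → Fin n → ℝ}
    (hA : ∀ i j, Continuous fun t => A t i j) (hF : ∀ i, Continuous fun t => F t i)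
    (t₀ : ℝ) (y₀ : Fin n → ℝ) :
    ∃ y : ℝ → Fin n → ℝ, y t₀ = y₀ ∧ ∀ t, HasDerivAt y (linearField A F t (y t)) t := by
  have hex := fun m : ℕ => exists_hasDerivWithinAt_linearField hA hF t₀ y₀
    (T := (m : ℝ) + 1) (by positivity)
  choose Y hY0 hY using hex
  have hYd : ∀ m : ℕ, ∀ t ∈ Ioo (t₀ - ((m : ℝ) + 1)) (t₀ + ((m : ℝ) + 1)),
      HasDerivAt (Y m) (linearField A F t (Y m t)) t := fun m t ht =>
    (hY m t (Ioo_subset_Icc_self ht)).hasDerivAt (Icc_mem_nhds ht.1 ht.2)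
  have huniq : ∀ m l : ℕ, m ≤ l →
      EqOn (Y m) (Y l) (Ioo (t₀ - ((m : ℝ) + 1)) (t₀ + ((m : ℝ) + 1))) := by
    intro m l hml
    have hml' : (m : ℝ) ≤ l := by exact_mod_cast hml
    obtain ⟨M, hM0, hM⟩ := exists_forall_abs_le hA (t₀ - ((m : ℝ) + 1)) (t₀ + ((m : ℝ) + 1))
    have hm : (0 : ℝ) ≤ m := m.cast_nonneg
    refine ODE_solution_unique_of_mem_Ioo (v := linearField A F) (s := fun _ => univ)
      (K := ⟨n * M, by positivity⟩) (t₀ := t₀) (fun t ht => ?_) ⟨by linarith, by linarith⟩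
      (fun t ht => ⟨hYd m t ht, mem_univ _⟩)
      (fun t ht => ⟨hYd l t ⟨by linarith [ht.1], by linarith [ht.2]⟩, mem_univ _⟩)
      (by rw [hY0, hY0])
    refine LipschitzOnWith.of_dist_le_mul fun x _ y _ => ?_
    rw [dist_eq_norm, dist_eq_norm]
    exact norm_linearField_sub_le (hM t (Ioo_subset_Icc_self ht)) x y
  have hmem : ∀ t, t ∈ Ioo (t₀ - ((⌈|t - t₀|⌉₊ : ℝ) + 1)) (t₀ + ((⌈|t - t₀|⌉₊ : ℝ) + 1)) := by
    intro t
    have h := abs_le.1 (Nat.le_ceil |t - t₀|)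
    exact ⟨by linarith [h.1], by linarith [h.2]⟩
  set y : ℝ → Fin n → ℝ := fun t => Y ⌈|t - t₀|⌉₊ t with hy
  have heq : ∀ m : ℕ, EqOn y (Y m) (Ioo (t₀ - ((m : ℝ) + 1)) (t₀ + ((m : ℝ) + 1))) := by
    intro m t ht
    rcases le_total m ⌈|t - t₀|⌉₊ with h | h
    · exact (huniq _ _ h ht).symm
    · exact huniq _ _ h (hmem t)
  refine ⟨y, by simp [hy, hY0], fun t => ?_⟩
  have hev := (heq ⌈|t - t₀|⌉₊).eventuallyEq_of_mem (isOpen_Ioo.mem_nhds (hmem t))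
  exact (hYd _ t (hmem t)).congr_of_eventuallyEq hev

lemma contDiff_of_hasDerivAt_linearField {n : ℕ} {A : ℝ → Fin n → Fin n → ℝ}
    {F : ℝ → Fin n → ℝ}
    (hA : ∀ i j, ContDiff ℝ (⊤ : ℕ∞) fun t => A t i j)
    (hF : ∀ i, ContDiff ℝ (⊤ : ℕ∞) fun t => F t i)
    {y : ℝ → Fin n → ℝ} (hy : ∀ t, HasDerivAt y (linearField A F t (y t)) t) :
    ContDiff ℝ (⊤ : ℕ∞) y := by
  refine contDiff_infty.2 fun m => ?_
  induction m with
  | zero => exact contDiff_zero.2 (continuous_iff_continuousAt.2 fun t => (hy t).continuousAt)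
  | succ m ih =>
    push_cast
    rw [contDiff_succ_iff_deriv]
    refine ⟨fun t => (hy t).differentiableAt, by simp, ?_⟩
    rw [show deriv y = fun t => linearField A F t (y t) from funext fun t => (hy t).deriv]
    unfold linearField
    refine contDiff_pi.2 fun i => ContDiff.add (ContDiff.sum fun j _ => ?_) ?_
    · exact ((hA i j).of_le (by exact_mod_cast le_top)).mul (contDiff_pi.1 ih j)
    · exact (hF i).of_le (by exact_mod_cast le_top)

/-- An `L²` Grönwall estimate, integrated backwards from the right endpoint. -/
lemma exists_sq_le_integral {n : ℕ} {A : ℝ → Fin n → Fin n → ℝ}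
    (hA : ∀ i j, Continuous fun t => A t i j) {a b : ℝ} (hab : a ≤ b) :
    ∃ C, 0 ≤ C ∧ ∀ (F : ℝ → Fin n → ℝ), (∀ i, Continuous fun t => F t i) →
      ∀ y : ℝ → Fin n → ℝ, (∀ t, HasDerivAt y (linearField A F t (y t)) t) → y b = 0 →
      ∀ t ∈ Icc a b, ∀ i, y t i ^ 2 ≤ C * ∫ s in a..b, ∑ j, F s j ^ 2 := by
  obtain ⟨M, hM0, hM⟩ := exists_forall_abs_le hA a b
  set κ : ℝ := 2 * (n * (n * M)) + 1 with hκ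
  have hκ0 : 0 ≤ κ := by positivity
  refine ⟨exp (κ * (b - a)), (exp_pos _).le, fun F hF y hy hyb t ht i => ?_⟩
  have hyi : ∀ s i, HasDerivAt (fun s => y s i) (∑ j, A s i j * y s j + F s i) s := fun s i =>
    hasDerivAt_pi.1 (hy s) i
  have hFc : Continuous fun s => ∑ j, F s j ^ 2 := by fun_prop
  set u : ℝ → ℝ := fun s => ∑ i, y s i ^ 2
  have hu : ∀ s, HasDerivAt u (∑ i, 2 * y s i * (∑ j, A s i j * y s j + F s i)) s := fun s => by
    have := HasDerivAt.fun_sum (u := Finset.univ) fun i _ => (hyi s i).fun_pow 2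
    simpa using this
  set Φ : ℝ → ℝ := fun s => exp (κ * (s - a)) * u s +
    exp (κ * (b - a)) * ∫ x in a..s, ∑ j, F x j ^ 2 with hΦ
  have hΦd : ∀ s, HasDerivAt Φ (exp (κ * (s - a)) * κ * u s + exp (κ * (s - a)) *
      (∑ i, 2 * y s i * (∑ j, A s i j * y s j + F s i)) +
      exp (κ * (b - a)) * ∑ j, F s j ^ 2) s := fun s => by
    have h1 : HasDerivAt (fun s => exp (κ * (s - a))) (exp (κ * (s - a)) * κ) s := by
      have := (((hasDerivAt_id s).sub_const a).const_mul κ).exp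
      simpa using this
    exact (h1.mul (hu s)).add ((intervalIntegral.integral_hasDerivAt_right
      (hFc.intervalIntegrable _ _) (hFc.stronglyMeasurableAtFilter _ _) hFc.continuousAt).const_mul _)
  have hmono : MonotoneOn Φ (Icc a b) := by
    refine monotoneOn_of_deriv_nonneg (convex_Icc a b)
      (fun s _ => (hΦd s).continuousAt.continuousWithinAt)
      (fun s _ => (hΦd s).differentiableAt.differentiableWithinAt) fun s hs => ?_
    rw [interior_Icc] at hs
    rw [(hΦd s).deriv]
    have hsum : ∀ i, |∑ j, A s i j * y s j| * |y s i| ≤ n * M * u s := by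
      intro i
      have hyle : ∀ l m, |y s l| * |y s m| ≤ u s := by
        intro l m
        have hl : y s l ^ 2 ≤ u s :=
          Finset.single_le_sum (f := fun i => y s i ^ 2) (fun i _ => sq_nonneg _)
            (Finset.mem_univ l)
        have hm : y s m ^ 2 ≤ u s :=
          Finset.single_le_sum (f := fun i => y s i ^ 2) (fun i _ => sq_nonneg _)
            (Finset.mem_univ m)
        nlinarith [sq_nonneg (|y s l| - |y s m|), sq_abs (y s l), sq_abs (y s m)]
      calc |∑ j, A s i j * y s j| * |y s i| ≤ (∑ j, |A s i j * y s j|) * |y s i| :=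
            mul_le_mul_of_nonneg_right (Finset.abs_sum_le_sum_abs _ _) (abs_nonneg _)
        _ = ∑ j, |A s i j| * (|y s j| * |y s i|) := by
            rw [Finset.sum_mul]; simp [abs_mul, mul_assoc]
        _ ≤ ∑ _j : Fin n, M * u s := Finset.sum_le_sum fun j _ =>
            mul_le_mul (hM s (Ioo_subset_Icc_self hs) i j) (hyle j i) (by positivity) hM0
        _ = n * M * u s := by simp [mul_assoc]
    have hterm : ∀ i, -(2 * (n * M * u s)) - y s i ^ 2 - F s i ^ 2 ≤
        2 * y s i * (∑ j, A s i j * y s j + F s i) := by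
      intro i
      have h1 := hsum i
      rw [← abs_mul] at h1
      nlinarith [neg_abs_le ((∑ j, A s i j * y s j) * y s i), sq_nonneg (y s i + F s i)]
    have hS := Finset.sum_le_sum fun i (_ : i ∈ Finset.univ) => hterm i
    rw [Finset.sum_sub_distrib, Finset.sum_sub_distrib] at hS
    simp only [Finset.sum_const, Finset.card_univ, Fintype.card_fin, nsmul_eq_mul] at hS
    change _ - u s - _ ≤ _ at hS
    set S := ∑ i, 2 * y s i * (∑ j, A s i j * y s j + F s i)
    set Q := ∑ j, F s j ^ 2
    have hQ : 0 ≤ Q := Finset.sum_nonneg fun j _ => sq_nonneg _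
    have hE : exp (κ * (s - a)) ≤ exp (κ * (b - a)) :=
      exp_le_exp.2 (mul_le_mul_of_nonneg_left (by linarith [hs.2]) hκ0)
    have h1 : 0 ≤ κ * u s + S + Q := by
      rw [hκ]; linarith
    have h2 := mul_nonneg (exp_pos (κ * (s - a))).le h1
    nlinarith [mul_le_mul_of_nonneg_right hE hQ]
  have hfin := hmono ht ⟨hab, le_rfl⟩ ht.2
  have hub : u b = 0 := by simp [u, hyb]
  simp only [hΦ, hub, mul_zero, zero_add] at hfin
  have hint : 0 ≤ ∫ x in a..t, ∑ j, F x j ^ 2 :=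
    intervalIntegral.integral_nonneg ht.1 fun x _ => Finset.sum_nonneg fun j _ => sq_nonneg _
  have h1 : y t i ^ 2 ≤ u t :=
    Finset.single_le_sum (f := fun i => y t i ^ 2) (fun i _ => sq_nonneg _) (Finset.mem_univ i)
  have h2 : 0 ≤ u t := (sq_nonneg _).trans h1
  have h3 : 1 ≤ exp (κ * (t - a)) := one_le_exp (mul_nonneg hκ0 (by linarith [ht.1]))
  nlinarith [mul_nonneg (exp_pos (κ * (b - a))).le hint]

/-- A smooth function on the whole line that agrees with `r ↦ r⁻¹` beyond `δ`. -/
lemma exists_contDiff_eq_inv {δ : ℝ} (hδ : 0 < δ) :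
    ∃ J : ℝ → ℝ, ContDiff ℝ (⊤ : ℕ∞) J ∧ ∀ r, δ < r → J r = r⁻¹ := by
  set χ : ℝ → ℝ := fun r => smoothTransition (2 / δ * r - 1) with hχ
  have hχs : ContDiff ℝ (⊤ : ℕ∞) χ := smoothTransition.contDiff.comp (by fun_prop)
  have hpos : ∀ r, r * χ r + (1 - χ r) ≠ 0 := by
    intro r
    rcases le_or_gt r 0 with hr | hr
    · have : χ r = 0 := smoothTransition.zero_of_nonpos (by
        have : 2 / δ * r ≤ 0 := mul_nonpos_of_nonneg_of_nonpos (by positivity) hr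
        linarith)
      simp [this]
    · have h0 : 0 ≤ χ r := smoothTransition.nonneg _
      have h1 : χ r ≤ 1 := smoothTransition.le_one _
      rcases h1.eq_or_lt with h | h
      · simp [h, hr.ne']
      · have := mul_nonneg hr.le h0
        exact ne_of_gt (by linarith)
  refine ⟨fun r => (r * χ r + (1 - χ r))⁻¹, ContDiff.inv (by fun_prop) hpos, fun r hr => ?_⟩
  have : χ r = 1 := smoothTransition.one_of_one_le (by
    have : 2 ≤ 2 / δ * r := by
      rw [div_mul_eq_mul_div, le_div_iff₀ hδ]; nlinarith
    linarith)
  simp [this]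

/-- The parameters of the linearised problem. The function `J` is a globally smooth stand-in for
`r ↦ r⁻¹`, and `c` is the constant of the slip condition `w₂' = c w₂` at the inner boundary. -/
structure FlowData where
  (R₁ R₂ μ c g k : ℝ)
  (ρ J : ℝ → ℝ)
  R₁_pos : 0 < R₁
  R₁_lt : R₁ < R₂
  μ_pos : 0 < μ
  c_nonneg : 0 ≤ c
  g_pos : 0 < g
  k_ne : k ≠ 0
  ρ_smooth : ContDiff ℝ (⊤ : ℕ∞) ρ
  ρ_pos : ∀ r ∈ Icc R₁ R₂, 0 < ρ r
  J_smooth : ContDiff ℝ (⊤ : ℕ∞) J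
  J_eq : ∀ r, R₁ / 2 < r → J r = r⁻¹

namespace FlowData

variable (d : FlowData)

lemma half_lt {r : ℝ} (hr : r ∈ Icc d.R₁ d.R₂) : d.R₁ / 2 < r := by
  linarith [d.R₁_pos, hr.1]

lemma pos_of_mem {r : ℝ} (hr : r ∈ Icc d.R₁ d.R₂) : 0 < r := d.R₁_pos.trans_le hr.1

lemma left_mem : d.R₁ ∈ Icc d.R₁ d.R₂ := ⟨le_rfl, d.R₁_lt.le⟩

lemma right_mem : d.R₂ ∈ Icc d.R₁ d.R₂ := ⟨d.R₁_lt.le, le_rfl⟩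

lemma contDiff_deriv_ρ : ContDiff ℝ (⊤ : ℕ∞) (deriv d.ρ) :=
  (contDiff_infty_iff_deriv.1 d.ρ_smooth).2

lemma hasDerivAt_J {r : ℝ} (hr : d.R₁ / 2 < r) : HasDerivAt d.J (-(r⁻¹) ^ 2) r := by
  have h0 : r ≠ 0 := by linarith [d.R₁_pos]
  have h := hasDerivAt_inv h0
  rw [← inv_pow] at h
  refine h.congr_of_eventuallyEq ?_
  filter_upwards [lt_mem_nhds hr] with x hx using d.J_eq x hx

/-- The coefficients of the first-order system for `(w₁, w₂, w₂', h₁)`. -/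
def coeff (lam r : ℝ) : Fin 4 → Fin 4 → ℝ :=
  ![![-d.J r, -(d.k * d.J r), 0, 0],
    ![0, 0, 1, 0],
    ![2 * d.k * d.J r ^ 2, (d.k ^ 2 + 1) * d.J r ^ 2 + lam * d.ρ r / d.μ, -d.J r,
      -(d.k / d.μ * d.J r)],
    ![-(d.μ * d.k ^ 2 * d.J r ^ 2) - lam * d.ρ r + d.g / lam * deriv d.ρ r,
      -(d.μ * d.k * d.J r ^ 2), -(d.μ * d.k * d.J r), 0]]

/-- A forcing term acting on the pressure equation only. -/
def force (f : ℝ → ℝ) (r : ℝ) : Fin 4 → ℝ := ![0, 0, 0, f r]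

lemma contDiff_coeff (lam : ℝ) (i j : Fin 4) :
    ContDiff ℝ (⊤ : ℕ∞) fun r => d.coeff lam r i j := by
  have h1 := d.J_smooth
  have h2 := d.ρ_smooth
  have h3 := d.contDiff_deriv_ρ
  fin_cases i <;> fin_cases j <;> simp [coeff] <;> fun_prop

lemma contDiff_force {f : ℝ → ℝ} (hf : ContDiff ℝ (⊤ : ℕ∞) f) (i : Fin 4) :
    ContDiff ℝ (⊤ : ℕ∞) fun r => force f r i := by
  fin_cases i <;> simp [force] <;> fun_prop

/-- Solutions of the forced first-order system. -/
def IsSol (lam : ℝ) (f : ℝ → ℝ) (y : ℝ → Fin 4 → ℝ) : Prop :=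
  ∀ t, HasDerivAt y (linearField (d.coeff lam) (force f) t (y t)) t

variable {d}

lemma exists_isSol (lam : ℝ) {f : ℝ → ℝ} (hf : ContDiff ℝ (⊤ : ℕ∞) f) (y₀ : Fin 4 → ℝ) :
    ∃ y, y d.R₂ = y₀ ∧ d.IsSol lam f y :=
  exists_hasDerivAt_linearField (fun i j => (d.contDiff_coeff lam i j).continuous)
    (fun i => (contDiff_force hf i).continuous) d.R₂ y₀

lemma IsSol.contDiff {lam : ℝ} {f : ℝ → ℝ} (hf : ContDiff ℝ (⊤ : ℕ∞) f) {y : ℝ → Fin 4 → ℝ}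
    (hy : d.IsSol lam f y) (i : Fin 4) : ContDiff ℝ (⊤ : ℕ∞) fun r => y r i :=
  contDiff_pi.1 (contDiff_of_hasDerivAt_linearField (d.contDiff_coeff lam) (contDiff_force hf) hy) i

lemma IsSol.add_smul {lam : ℝ} {f f' : ℝ → ℝ} {y z : ℝ → Fin 4 → ℝ} (hy : d.IsSol lam f y)
    (hz : d.IsSol lam f' z) (s : ℝ) :
    d.IsSol lam (fun r => f r + s * f' r) (fun r => y r + s • z r) := by
  intro t
  refine ((hy t).add ((hz t).const_smul s)).congr_deriv ?_
  ext i
  fin_cases i <;> simp [linearField, force, Fin.sum_univ_four] <;> ring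

lemma IsSol.hasDerivAt_zero {lam : ℝ} {f : ℝ → ℝ} {y : ℝ → Fin 4 → ℝ} (hy : d.IsSol lam f y)
    (r : ℝ) : HasDerivAt (fun r => y r 0) (-d.J r * (y r 0 + d.k * y r 1)) r := by
  refine (hasDerivAt_pi.1 (hy r) 0).congr_deriv ?_
  simp [linearField, coeff, force, Fin.sum_univ_four]
  ring

lemma IsSol.hasDerivAt_one {lam : ℝ} {f : ℝ → ℝ} {y : ℝ → Fin 4 → ℝ} (hy : d.IsSol lam f y)
    (r : ℝ) : HasDerivAt (fun r => y r 1) (y r 2) r := by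
  refine (hasDerivAt_pi.1 (hy r) 1).congr_deriv ?_
  simp [linearField, coeff, force, Fin.sum_univ_four]

lemma IsSol.hasDerivAt_two {lam : ℝ} {f : ℝ → ℝ} {y : ℝ → Fin 4 → ℝ} (hy : d.IsSol lam f y)
    (r : ℝ) : HasDerivAt (fun r => y r 2) (2 * d.k * d.J r ^ 2 * y r 0 +
      ((d.k ^ 2 + 1) * d.J r ^ 2 + lam * d.ρ r / d.μ) * y r 1 - d.J r * y r 2 -
      d.k / d.μ * d.J r * y r 3) r := by
  refine (hasDerivAt_pi.1 (hy r) 2).congr_deriv ?_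
  simp [linearField, coeff, force, Fin.sum_univ_four]
  ring

lemma IsSol.hasDerivAt_three {lam : ℝ} {f : ℝ → ℝ} {y : ℝ → Fin 4 → ℝ} (hy : d.IsSol lam f y)
    (r : ℝ) : HasDerivAt (fun r => y r 3)
      ((-(d.μ * d.k ^ 2 * d.J r ^ 2) - lam * d.ρ r + d.g / lam * deriv d.ρ r) * y r 0 -
        d.μ * d.k * d.J r ^ 2 * y r 1 - d.μ * d.k * d.J r * y r 2 + f r) r := by
  refine (hasDerivAt_pi.1 (hy r) 3).congr_deriv ?_
  simp [linearField, coeff, force, Fin.sum_univ_four]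
  ring

lemma IsSol.hasDerivAt_deriv_zero {lam : ℝ} {f : ℝ → ℝ} {y : ℝ → Fin 4 → ℝ}
    (hy : d.IsSol lam f y) {r : ℝ} (hr : d.R₁ / 2 < r) :
    HasDerivAt (deriv fun r => y r 0) ((r⁻¹) ^ 2 * (y r 0 + d.k * y r 1) +
      -r⁻¹ * (-r⁻¹ * (y r 0 + d.k * y r 1) + d.k * y r 2)) r := by
  rw [show deriv (fun r => y r 0) = fun r => -d.J r * (y r 0 + d.k * y r 1) from
    funext fun r => (hy.hasDerivAt_zero r).deriv]
  refine ((d.hasDerivAt_J hr).neg.mul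
    ((hy.hasDerivAt_zero r).add ((hy.hasDerivAt_one r).const_mul d.k))).congr_deriv ?_
  simp only [d.J_eq r hr, Pi.neg_apply, Pi.add_apply]
  ring

/-- The boundary conditions at both ends. -/
structure BoundaryCond (d : FlowData) (y : ℝ → Fin 4 → ℝ) : Prop where
  left_zero : y d.R₁ 0 = 0
  left_slip : y d.R₁ 2 = d.c * y d.R₁ 1
  right_zero : y d.R₂ 0 = 0
  right_one : y d.R₂ 1 = 0

/-- Velocity profiles that are divergence free and satisfy the essential boundary conditions. -/
structure Admissible (d : FlowData) (u v : ℝ → ℝ) : Prop where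
  smooth_fst : ContDiff ℝ (⊤ : ℕ∞) u
  smooth_snd : ContDiff ℝ (⊤ : ℕ∞) v
  div_free : ∀ r ∈ Icc d.R₁ d.R₂, deriv u r = -r⁻¹ * (u r + d.k * v r)
  left_fst : u d.R₁ = 0
  right_fst : u d.R₂ = 0
  right_snd : v d.R₂ = 0

lemma IsSol.admissible {lam : ℝ} {f : ℝ → ℝ} (hf : ContDiff ℝ (⊤ : ℕ∞) f) {y : ℝ → Fin 4 → ℝ}
    (hy : d.IsSol lam f y) (hb : d.BoundaryCond y) :
    d.Admissible (fun r => y r 0) (fun r => y r 1) where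
  smooth_fst := hy.contDiff hf 0
  smooth_snd := hy.contDiff hf 1
  div_free r hr := by rw [(hy.hasDerivAt_zero r).deriv, d.J_eq r (d.half_lt hr)]
  left_fst := hb.left_zero
  right_fst := hb.right_zero
  right_snd := hb.right_one

lemma Admissible.add_mul {u v u' v' : ℝ → ℝ} (h : d.Admissible u v) (h' : d.Admissible u' v')
    (s : ℝ) : d.Admissible (fun r => u r + s * u' r) (fun r => v r + s * v' r) where
  smooth_fst := h.smooth_fst.add (contDiff_const.mul h'.smooth_fst)
  smooth_snd := h.smooth_snd.add (contDiff_const.mul h'.smooth_snd)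
  div_free r hr := by
    have h1 := h.smooth_fst.differentiable (by simp) r
    have h2 := h'.smooth_fst.differentiable (by simp) r
    rw [deriv_fun_add h1 (h2.const_mul s), deriv_const_mul _ h2, h.div_free r hr, h'.div_free r hr]
    ring
  left_fst := by simp [h.left_fst, h'.left_fst]
  right_fst := by simp [h.right_fst, h'.right_fst]
  right_snd := by simp [h.right_snd, h'.right_snd]

variable (d)

/-- The mass of the radial component. -/
def mass (u : ℝ → ℝ) : ℝ := ∫ r in d.R₁..d.R₂, r * u r ^ 2

/-- Twice the kinetic energy. -/
def kinetic (u v : ℝ → ℝ) : ℝ := ∫ r in d.R₁..d.R₂, r * d.ρ r * (u r ^ 2 + v r ^ 2)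

/-- The viscous dissipation, including the contribution of the slip boundary. -/
def dissipation (u v : ℝ → ℝ) : ℝ :=
  (∫ r in d.R₁..d.R₂, d.μ * (r * (deriv u r ^ 2 + deriv v r ^ 2) +
    d.J r * ((d.k ^ 2 + 1) * (u r ^ 2 + v r ^ 2) + 4 * d.k * (u r * v r)))) +
    d.μ * d.c * d.R₁ * v d.R₁ ^ 2

/-- The work done by buoyancy. -/
def buoyancy (u : ℝ → ℝ) : ℝ := ∫ r in d.R₁..d.R₂, r * deriv d.ρ r * u r ^ 2

/-- The energy form of the problem at growth rate `lam`. -/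
def energy (lam : ℝ) (u v : ℝ → ℝ) : ℝ :=
  lam ^ 2 * d.kinetic u v + lam * d.dissipation u v - d.g * d.buoyancy u

/-- The density of the polarised energy form. -/
def density (lam : ℝ) (a b u v : ℝ → ℝ) (r : ℝ) : ℝ :=
  lam ^ 2 * (r * d.ρ r * (a r * u r + b r * v r)) +
    lam * (d.μ * (r * (deriv a r * deriv u r + deriv b r * deriv v r) +
      d.J r * ((d.k ^ 2 + 1) * (a r * u r + b r * v r) +
        2 * d.k * (a r * v r + b r * u r)))) -
    d.g * (r * deriv d.ρ r * (a r * u r))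

variable {d}

lemma continuous_density (lam : ℝ) {a b u v : ℝ → ℝ} (ha : ContDiff ℝ (⊤ : ℕ∞) a)
    (hb : ContDiff ℝ (⊤ : ℕ∞) b) (hu : ContDiff ℝ (⊤ : ℕ∞) u) (hv : ContDiff ℝ (⊤ : ℕ∞) v) :
    Continuous (d.density lam a b u v) := by
  have h1 := d.J_smooth.continuous
  have h2 := d.ρ_smooth.continuous
  have h3 := d.contDiff_deriv_ρ.continuous
  have h4 := ha.continuous
  have h5 := hb.continuous
  have h6 := hu.continuous
  have h7 := hv.continuous
  have h8 := ha.continuous_deriv (by simp)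
  have h9 := hb.continuous_deriv (by simp)
  have h10 := hu.continuous_deriv (by simp)
  have h11 := hv.continuous_deriv (by simp)
  unfold density
  fun_prop

lemma energy_eq (lam : ℝ) {u v : ℝ → ℝ} (hu : ContDiff ℝ (⊤ : ℕ∞) u)
    (hv : ContDiff ℝ (⊤ : ℕ∞) v) :
    d.energy lam u v = (∫ r in d.R₁..d.R₂, d.density lam u v u v r) +
      lam * (d.μ * d.c * d.R₁ * v d.R₁ ^ 2) := by
  have h1 := d.J_smooth.continuous
  have h2 := d.ρ_smooth.continuous
  have h3 := d.contDiff_deriv_ρ.continuous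
  have h6 := hu.continuous
  have h7 := hv.continuous
  have h10 := hu.continuous_deriv (by simp)
  have h11 := hv.continuous_deriv (by simp)
  rw [energy, kinetic, dissipation, buoyancy, mul_add, ← intervalIntegral.integral_const_mul,
    ← intervalIntegral.integral_const_mul, ← intervalIntegral.integral_const_mul, ← add_assoc,
    ← intervalIntegral.integral_add, add_sub_right_comm, ← intervalIntegral.integral_sub]
  · congr 1
    refine intervalIntegral.integral_congr fun r _ => ?_
    simp only [density]
    ring
  all_goals exact Continuous.intervalIntegrable (by fun_prop) _ _

lemma energy_add_mul (lam : ℝ) {a b u v : ℝ → ℝ} (ha : ContDiff ℝ (⊤ : ℕ∞) a)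
    (hb : ContDiff ℝ (⊤ : ℕ∞) b) (hu : ContDiff ℝ (⊤ : ℕ∞) u) (hv : ContDiff ℝ (⊤ : ℕ∞) v)
    (s : ℝ) :
    d.energy lam (fun r => a r + s * u r) (fun r => b r + s * v r) =
      d.energy lam a b + 2 * s * ((∫ r in d.R₁..d.R₂, d.density lam a b u v r) +
        lam * (d.μ * d.c * d.R₁ * (b d.R₁ * v d.R₁))) + s ^ 2 * d.energy lam u v := by
  have hda := ha.differentiable (by simp)
  have hdb := hb.differentiable (by simp)
  have hdu := hu.differentiable (by simp)
  have hdv := hv.differentiable (by simp)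
  rw [energy_eq lam (by fun_prop) (by fun_prop), energy_eq lam ha hb, energy_eq lam hu hv]
  have hI : ∫ r in d.R₁..d.R₂, d.density lam (fun r => a r + s * u r) (fun r => b r + s * v r)
      (fun r => a r + s * u r) (fun r => b r + s * v r) r =
      (∫ r in d.R₁..d.R₂, d.density lam a b a b r) +
      2 * s * (∫ r in d.R₁..d.R₂, d.density lam a b u v r) +
      s ^ 2 * ∫ r in d.R₁..d.R₂, d.density lam u v u v r := by
    rw [← intervalIntegral.integral_const_mul, ← intervalIntegral.integral_const_mul,
      ← intervalIntegral.integral_add, ← intervalIntegral.integral_add]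
    · refine intervalIntegral.integral_congr fun r _ => ?_
      simp only [density]
      rw [deriv_fun_add (hda r) ((hdu r).const_mul s), deriv_const_mul _ (hdu r),
        deriv_fun_add (hdb r) ((hdv r).const_mul s), deriv_const_mul _ (hdv r)]
      ring
    · exact ((continuous_density lam ha hb ha hb).add
        (continuous_const.mul (continuous_density lam ha hb hu hv))).intervalIntegrable _ _
    · exact (continuous_const.mul (continuous_density lam hu hv hu hv)).intervalIntegrable _ _
    · exact (continuous_density lam ha hb ha hb).intervalIntegrable _ _
    · exact (continuous_const.mul (continuous_density lam ha hb hu hv)).intervalIntegrable _ _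
  rw [hI]
  ring

/-- The weak form of the forced problem. -/
lemma IsSol.weak_form {lam : ℝ} (hlam : lam ≠ 0) {f : ℝ → ℝ} (hf : ContDiff ℝ (⊤ : ℕ∞) f)
    {y : ℝ → Fin 4 → ℝ} (hy : d.IsSol lam f y) (hb : d.BoundaryCond y) {u v : ℝ → ℝ}
    (huv : d.Admissible u v) :
    (∫ r in d.R₁..d.R₂, d.density lam (fun r => y r 0) (fun r => y r 1) u v r) +
      lam * (d.μ * d.c * d.R₁ * (y d.R₁ 1 * v d.R₁)) =
      lam * ∫ r in d.R₁..d.R₂, r * (f r * u r) := by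
  have hμ := d.μ_pos.ne'
  have hu := huv.smooth_fst
  have hv := huv.smooth_snd
  have hy0 := hy.contDiff hf 0
  have hy1 := hy.contDiff hf 1
  have hcd := continuous_density (d := d) lam hy0 hy1 hu hv
  have hcf : Continuous fun r => lam * (r * (f r * u r)) := by
    have := hf.continuous
    have := hu.continuous
    fun_prop
  set G : ℝ → ℝ := fun r => lam * (d.μ * (r * (deriv (fun r => y r 0) r * u r + y r 2 * v r)) -
    r * (y r 3 * u r)) with hG
  have hGd : ∀ r ∈ Icc d.R₁ d.R₂, HasDerivAt G
      (d.density lam (fun r => y r 0) (fun r => y r 1) u v r - lam * (r * (f r * u r))) r := by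
    intro r hr
    have hr' := d.half_lt hr
    have hr0 : r ≠ 0 := (d.pos_of_mem hr).ne'
    have du := (hu.differentiable (by simp) r).hasDerivAt
    have dv := (hv.differentiable (by simp) r).hasDerivAt
    have h := ((((hasDerivAt_id r).mul (((hy.hasDerivAt_deriv_zero hr').mul du).add
      ((hy.hasDerivAt_two r).mul dv))).const_mul d.μ).sub
      ((hasDerivAt_id r).mul ((hy.hasDerivAt_three r).mul du))).const_mul lam
    refine h.congr_deriv ?_
    simp only [density, (hy.hasDerivAt_zero r).deriv, (hy.hasDerivAt_one r).deriv,
      huv.div_free r hr, d.J_eq r hr', Pi.mul_apply, Pi.add_apply, id]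
    have hk := d.k_ne
    field_simp
    ring
  have hint := intervalIntegral.integral_eq_sub_of_hasDerivAt (f := G)
    (f' := fun r => d.density lam (fun r => y r 0) (fun r => y r 1) u v r -
      lam * (r * (f r * u r))) (a := d.R₁) (b := d.R₂)
    (fun r hr => hGd r (by rwa [uIcc_of_le d.R₁_lt.le] at hr))
    ((hcd.sub hcf).intervalIntegrable _ _)
  rw [intervalIntegral.integral_sub (hcd.intervalIntegrable _ _) (hcf.intervalIntegrable _ _),
    intervalIntegral.integral_const_mul] at hint
  simp only [hG, huv.left_fst, huv.right_fst, huv.right_snd, hb.left_slip] at hint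
  linear_combination hint

lemma IsSol.eq_zero_of_forall_eq_zero {lam : ℝ} {y : ℝ → Fin 4 → ℝ}
    (hy : d.IsSol lam (fun _ => 0) y) (h : ∀ r ∈ Icc d.R₁ d.R₂, y r 0 = 0) :
    y d.R₂ = 0 := by
  have hk := d.k_ne
  have hμ := d.μ_pos.ne'
  have hev : ∀ {F : ℝ → ℝ}, (∀ r ∈ Ioo d.R₁ d.R₂, F r = 0) → ∀ r ∈ Ioo d.R₁ d.R₂,
      ∀ F', HasDerivAt F F' r → F' = 0 := by
    intro F hF r hr F' hF'
    have : F =ᶠ[nhds r] fun _ => 0 := by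
      filter_upwards [isOpen_Ioo.mem_nhds hr] with x hx using hF x hx
    exact hF'.unique ((hasDerivAt_const r (0 : ℝ)).congr_of_eventuallyEq this)
  have h0 : ∀ r ∈ Ioo d.R₁ d.R₂, y r 0 = 0 := fun r hr => h r (Ioo_subset_Icc_self hr)
  have hJ : ∀ r ∈ Ioo d.R₁ d.R₂, d.J r ≠ 0 := fun r hr => by
    rw [d.J_eq r (d.half_lt (Ioo_subset_Icc_self hr))]
    exact inv_ne_zero (d.pos_of_mem (Ioo_subset_Icc_self hr)).ne'
  have h1 : ∀ r ∈ Ioo d.R₁ d.R₂, y r 1 = 0 := fun r hr => by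
    have := hev h0 r hr _ (hy.hasDerivAt_zero r)
    simpa [h0 r hr, hJ r hr, hk] using this
  have h2 : ∀ r ∈ Ioo d.R₁ d.R₂, y r 2 = 0 := fun r hr =>
    hev h1 r hr _ (hy.hasDerivAt_one r)
  have h3 : ∀ r ∈ Ioo d.R₁ d.R₂, y r 3 = 0 := fun r hr => by
    have := hev h2 r hr _ (hy.hasDerivAt_two r)
    simpa [h0 r hr, h1 r hr, h2 r hr, hJ r hr, hk, hμ] using this
  have hlim : ∀ i, (∀ r ∈ Ioo d.R₁ d.R₂, y r i = 0) → y d.R₂ i = 0 := by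
    intro i hi
    have hc : Continuous fun r => y r i := continuous_iff_continuousAt.2 fun r =>
      (hasDerivAt_pi.1 (hy r) i).continuousAt
    have hcl : closure (Ioo d.R₁ d.R₂) ⊆ {r | y r i = 0} :=
      closure_minimal hi (isClosed_eq hc continuous_const)
    rw [closure_Ioo d.R₁_lt.ne] at hcl
    exact hcl d.right_mem
  ext i
  fin_cases i
  exacts [hlim 0 h0, hlim 1 h1, hlim 2 h2, hlim 3 h3]

/-- If the homogeneous boundary value problem has only the trivial solution, then the forced
problem is solvable with an `L²` bound. -/
lemma exists_response {lam : ℝ}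
    (huniq : ∀ y, d.IsSol lam (fun _ => 0) y → d.BoundaryCond y → y d.R₂ = 0) :
    ∃ C, 0 ≤ C ∧ ∀ f : ℝ → ℝ, ContDiff ℝ (⊤ : ℕ∞) f → ∃ y, d.IsSol lam f y ∧ d.BoundaryCond y ∧
      ∀ r ∈ Icc d.R₁ d.R₂, y r 0 ^ 2 ≤ C * ∫ s in d.R₁..d.R₂, f s ^ 2 := by
  have hz : ContDiff ℝ (⊤ : ℕ∞) fun _ : ℝ => (0 : ℝ) := contDiff_const
  obtain ⟨ya, hya0, hya⟩ := exists_isSol (d := d) lam hz ![0, 0, 1, 0]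
  obtain ⟨yb, hyb0, hyb⟩ := exists_isSol (d := d) lam hz ![0, 0, 0, 1]
  set α₁ := ya d.R₁ 0 with hα₁
  set α₂ := ya d.R₁ 2 - d.c * ya d.R₁ 1 with hα₂
  set β₁ := yb d.R₁ 0 with hβ₁
  set β₂ := yb d.R₁ 2 - d.c * yb d.R₁ 1 with hβ₂
  set D := α₁ * β₂ - β₁ * α₂ with hD
  have hcomb : ∀ {f : ℝ → ℝ} {y : ℝ → Fin 4 → ℝ}, d.IsSol lam f y → ∀ p q : ℝ,
      d.IsSol lam f fun r => y r + p • ya r + q • yb r := by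
    intro f y hy p q
    simpa using (hy.add_smul hya p).add_smul hyb q
  have hD0 : D ≠ 0 := by
    intro h0
    obtain ⟨v, hv, hv0⟩ := Matrix.exists_mulVec_eq_zero_iff (M := !![α₁, β₁; α₂, β₂]) |>.2
      (by rw [Matrix.det_fin_two_of]; exact h0)
    have e1 := congrFun hv0 0
    have e2 := congrFun hv0 1
    simp [Matrix.mulVec, dotProduct, Fin.sum_univ_two] at e1 e2
    have hzero : d.IsSol lam (fun _ => 0) fun _ => (0 : Fin 4 → ℝ) := by
      intro t
      refine (hasDerivAt_const t (0 : Fin 4 → ℝ)).congr_deriv ?_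
      ext i
      fin_cases i <;> simp [linearField, force]
    have hsol := hcomb hzero (v 0) (v 1)
    have hr := huniq _ hsol ⟨by simp; linarith, by simp; linarith, by simp [hya0, hyb0],
      by simp [hya0, hyb0]⟩
    simp only [hya0, hyb0] at hr
    have r2 := congrFun hr 2
    have r3 := congrFun hr 3
    simp at r2 r3
    apply hv
    ext i
    fin_cases i
    exacts [r2, r3]
  obtain ⟨C₀, hC₀, hG⟩ := exists_sq_le_integral
    (fun i j => (d.contDiff_coeff lam i j).continuous) d.R₁_lt.le
  obtain ⟨Ba, hBa⟩ := isCompact_Icc.exists_bound_of_continuousOn (s := Icc d.R₁ d.R₂)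
    (hya.contDiff hz 0).continuous.continuousOn
  obtain ⟨Bb, hBb⟩ := isCompact_Icc.exists_bound_of_continuousOn (s := Icc d.R₁ d.R₂)
    (hyb.contDiff hz 0).continuous.continuousOn
  set K := C₀ * (2 + 2 * d.c ^ 2)
  have hK0 : 0 ≤ K := by positivity
  set Ka := 2 * (β₁ ^ 2 + β₂ ^ 2) / D ^ 2 * K
  set Kb := 2 * (α₁ ^ 2 + α₂ ^ 2) / D ^ 2 * K
  refine ⟨3 * (C₀ + Ka * Ba ^ 2 + Kb * Bb ^ 2), by positivity, fun f hf => ?_⟩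
  obtain ⟨yp, hyp0, hyp⟩ := exists_isSol (d := d) lam hf 0
  set I := ∫ s in d.R₁..d.R₂, f s ^ 2 with hI
  have hbd : ∀ r ∈ Icc d.R₁ d.R₂, ∀ i, yp r i ^ 2 ≤ C₀ * I := by
    intro r hr i
    have := hG (force f) (fun i => (contDiff_force hf i).continuous) yp hyp hyp0 r hr i
    simpa [force, Fin.sum_univ_four] using this
  have hI0 : 0 ≤ I := intervalIntegral.integral_nonneg d.R₁_lt.le fun s _ => sq_nonneg _
  set σ₁ := yp d.R₁ 0 with hσ₁
  set σ₂ := yp d.R₁ 2 - d.c * yp d.R₁ 1 with hσ₂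
  have hCI : 0 ≤ C₀ * I := mul_nonneg hC₀ hI0
  have b1 : σ₁ ^ 2 ≤ K * I := by
    have := hbd _ d.left_mem 0
    have h2 : 0 ≤ C₀ * I * (1 + 2 * d.c ^ 2) := by positivity
    calc σ₁ ^ 2 ≤ C₀ * I := this
      _ ≤ K * I := by simp only [K]; linarith
  have b2 : σ₂ ^ 2 ≤ K * I := by
    have h2 := hbd _ d.left_mem 2
    have h1 := mul_le_mul_of_nonneg_left (hbd _ d.left_mem 1) (sq_nonneg d.c)
    have h3 := sq_nonneg (yp d.R₁ 2 + d.c * yp d.R₁ 1)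
    simp only [K, hσ₂]
    linarith
  set p := (β₁ * σ₂ - β₂ * σ₁) / D with hp
  set q := (α₂ * σ₁ - α₁ * σ₂) / D with hq
  have hpq : ∀ x z : ℝ, ((x * σ₂ - z * σ₁) / D) ^ 2 ≤ 2 * (x ^ 2 + z ^ 2) / D ^ 2 * K * I := by
    intro x z
    rw [div_pow, mul_assoc (_ / _), div_mul_eq_mul_div]
    gcongr
    linarith [sq_nonneg (x * σ₂ + z * σ₁), mul_le_mul_of_nonneg_left b2 (sq_nonneg x),
      mul_le_mul_of_nonneg_left b1 (sq_nonneg z)]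
  have hpb : p ^ 2 ≤ Ka * I := hpq β₁ β₂
  have hqb : q ^ 2 ≤ Kb * I := by
    have := hpq α₁ α₂
    rw [← neg_sub (α₂ * σ₁), neg_div, neg_sq] at this
    exact this
  refine ⟨_, hcomb hyp p q, ⟨?_, ?_, by simp [hya0, hyb0, hyp0], by simp [hya0, hyb0, hyp0]⟩, ?_⟩
  · change σ₁ + p * α₁ + q * β₁ = 0
    rw [hp, hq]
    field_simp
    rw [hD]
    ring
  · have : σ₂ + p * α₂ + q * β₂ = 0 := by
      rw [hp, hq]
      field_simp
      rw [hD]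
      ring
    simp only [Pi.add_apply, Pi.smul_apply, smul_eq_mul]
    rw [hσ₂, hα₂, hβ₂] at this
    linarith
  · intro r hr
    simp only [Pi.add_apply, Pi.smul_apply, smul_eq_mul]
    have ha : ya r 0 ^ 2 ≤ Ba ^ 2 := sq_le_sq' (abs_le.1 (hBa r hr)).1 (abs_le.1 (hBa r hr)).2
    have hb : yb r 0 ^ 2 ≤ Bb ^ 2 := sq_le_sq' (abs_le.1 (hBb r hr)).1 (abs_le.1 (hBb r hr)).2
    have h1 : (p * ya r 0) ^ 2 ≤ Ka * I * Ba ^ 2 := by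
      rw [mul_pow]; exact mul_le_mul hpb ha (sq_nonneg _) ((sq_nonneg _).trans hpb)
    have h2 : (q * yb r 0) ^ 2 ≤ Kb * I * Bb ^ 2 := by
      rw [mul_pow]; exact mul_le_mul hqb hb (sq_nonneg _) ((sq_nonneg _).trans hqb)
    have h3 := hbd r hr 0
    nlinarith [sq_nonneg (yp r 0 - p * ya r 0), sq_nonneg (yp r 0 - q * yb r 0),
      sq_nonneg (p * ya r 0 - q * yb r 0)]

/-- The forced problem with forcing `u` yields a competitor whose polar energy against `(u, v)`
is the mass of `u` and whose own energy is controlled by that mass. -/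
lemma exists_competitor {lam : ℝ} (hlam : 0 < lam)
    (huniq : ∀ y, d.IsSol lam (fun _ => 0) y → d.BoundaryCond y → y d.R₂ = 0) :
    ∃ C, ∀ u v, d.Admissible u v → ∃ a b, d.Admissible a b ∧
      (∀ s, d.energy lam (fun r => a r + s * u r) (fun r => b r + s * v r) =
        d.energy lam a b + 2 * s * (lam * d.mass u) + s ^ 2 * d.energy lam u v) ∧
      d.energy lam a b ≤ C * d.mass u := by
  obtain ⟨C, hC, hresp⟩ := exists_response huniq
  have hR₁ := d.R₁_pos
  set T := ∫ r in d.R₁..d.R₂, r with hT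
  have hT0 : 0 ≤ T := intervalIntegral.integral_nonneg d.R₁_lt.le fun _ hr => (d.pos_of_mem hr).le
  refine ⟨lam * (1 / 2 + 1 / 2 * (C / d.R₁ * T)), fun u v huv => ?_⟩
  have hu := huv.smooth_fst.continuous
  obtain ⟨y, hy, hb, hbd⟩ := hresp u huv.smooth_fst
  have hadm := hy.admissible huv.smooth_fst hb
  have hyc := hadm.smooth_fst.continuous
  refine ⟨_, _, hadm, fun s => ?_, ?_⟩
  · rw [energy_add_mul lam hadm.smooth_fst hadm.smooth_snd huv.smooth_fst huv.smooth_snd,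
      hy.weak_form hlam.ne' huv.smooth_fst hb huv]
    simp only [mass, pow_two]
  · have h1 := hy.weak_form hlam.ne' huv.smooth_fst hb hadm
    rw [← pow_two, ← energy_eq lam hadm.smooth_fst hadm.smooth_snd] at h1
    rw [h1, mul_assoc]
    refine mul_le_mul_of_nonneg_left ?_ hlam.le
    have hmass : d.R₁ * ∫ r in d.R₁..d.R₂, u r ^ 2 ≤ d.mass u := by
      rw [mass, ← intervalIntegral.integral_const_mul]
      refine intervalIntegral.integral_mono_on d.R₁_lt.le
        (Continuous.intervalIntegrable (by fun_prop) _ _)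
        (Continuous.intervalIntegrable (by fun_prop) _ _) fun r hr => ?_
      exact mul_le_mul_of_nonneg_right hr.1 (sq_nonneg _)
    set I := ∫ r in d.R₁..d.R₂, u r ^ 2
    have hI : C * I ≤ C / d.R₁ * d.mass u := by
      rw [div_mul_eq_mul_div, le_div_iff₀ hR₁]
      nlinarith
    have h2 : ∫ r in d.R₁..d.R₂, r * (u r * y r 0) ≤
        ∫ r in d.R₁..d.R₂, (1 / 2 * (r * u r ^ 2) + 1 / 2 * (C * I) * r) := by
      refine intervalIntegral.integral_mono_on d.R₁_lt.le
        (Continuous.intervalIntegrable (by fun_prop) _ _)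
        (Continuous.intervalIntegrable (by fun_prop) _ _) fun r hr => ?_
      have h3 : u r * y r 0 ≤ 1 / 2 * u r ^ 2 + 1 / 2 * (C * I) := by
        linarith [hbd r hr, sq_nonneg (u r - y r 0)]
      linarith [mul_le_mul_of_nonneg_left h3 (d.pos_of_mem hr).le]
    rw [intervalIntegral.integral_add (Continuous.intervalIntegrable (by fun_prop) _ _)
      (Continuous.intervalIntegrable (by fun_prop) _ _), intervalIntegral.integral_const_mul,
      intervalIntegral.integral_const_mul] at h2
    change _ ≤ 1 / 2 * d.mass u + 1 / 2 * (C * I) * T at h2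
    linarith [mul_le_mul_of_nonneg_right hI hT0]

lemma mass_nonneg (u : ℝ → ℝ) : 0 ≤ d.mass u :=
  intervalIntegral.integral_nonneg d.R₁_lt.le fun _ hr =>
    mul_nonneg (d.pos_of_mem hr).le (sq_nonneg _)

lemma kinetic_nonneg (u v : ℝ → ℝ) : 0 ≤ d.kinetic u v :=
  intervalIntegral.integral_nonneg d.R₁_lt.le fun r hr =>
    mul_nonneg (mul_nonneg (d.pos_of_mem hr).le (d.ρ_pos r hr).le) (by positivity)

lemma dissipation_nonneg (u v : ℝ → ℝ) : 0 ≤ d.dissipation u v := by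
  have hμ := d.μ_pos
  have hc := d.c_nonneg
  have hR₁ := d.R₁_pos
  refine add_nonneg (intervalIntegral.integral_nonneg d.R₁_lt.le fun r hr => ?_) (by positivity)
  have hr0 := d.pos_of_mem hr
  have hJ : 0 ≤ d.J r := by
    rw [d.J_eq r (d.half_lt hr)]
    exact inv_nonneg.2 hr0.le
  have h : (d.k ^ 2 + 1) * (u r ^ 2 + v r ^ 2) + 4 * d.k * (u r * v r) =
      (u r + d.k * v r) ^ 2 + (d.k * u r + v r) ^ 2 := by ring
  rw [h]
  positivity

lemma exists_buoyancy_le (d : FlowData) :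
    ∃ C, 0 < C ∧ ∀ u, ContDiff ℝ (⊤ : ℕ∞) u → d.buoyancy u ≤ C * d.mass u := by
  have hρ := d.contDiff_deriv_ρ.continuous
  obtain ⟨B, hB⟩ := isCompact_Icc.exists_bound_of_continuousOn (s := Icc d.R₁ d.R₂) hρ.continuousOn
  have hB0 : 0 ≤ B := (norm_nonneg _).trans (hB _ d.left_mem)
  refine ⟨B + 1, by linarith, fun u hu => ?_⟩
  have hu := hu.continuous
  rw [mass, buoyancy, ← intervalIntegral.integral_const_mul]
  refine intervalIntegral.integral_mono_on d.R₁_lt.le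
    (Continuous.intervalIntegrable (by fun_prop) _ _)
    (Continuous.intervalIntegrable (by fun_prop) _ _) fun r hr => ?_
  have h1 := (abs_le.1 (hB r hr)).2
  have h2 := mul_nonneg (d.pos_of_mem hr).le (sq_nonneg (u r))
  nlinarith

lemma exists_energy_nonneg (d : FlowData) :
    ∃ lam, 0 < lam ∧ ∀ u v, d.Admissible u v → 0 ≤ d.energy lam u v := by
  have hρ := d.ρ_smooth.continuous
  have hρ' := d.contDiff_deriv_ρ.continuous
  have hg := d.g_pos
  obtain ⟨B, hB⟩ := isCompact_Icc.exists_bound_of_continuousOn (s := Icc d.R₁ d.R₂)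
    hρ'.continuousOn
  have hB0 : 0 ≤ B := (norm_nonneg _).trans (hB _ d.left_mem)
  obtain ⟨x, hx, hmin⟩ := isCompact_Icc.exists_isMinOn ⟨_, d.left_mem⟩ hρ.continuousOn
  have hm := d.ρ_pos x hx
  set lam := 1 + d.g * B / d.ρ x with hlam
  have hlam1 : 1 ≤ lam := by
    have : 0 ≤ d.g * B / d.ρ x := by positivity
    linarith
  refine ⟨lam, by linarith, fun u v huv => ?_⟩
  have hu := huv.smooth_fst.continuous
  have hv := huv.smooth_snd.continuous
  have hkey : ∀ r ∈ Icc d.R₁ d.R₂, d.g * deriv d.ρ r ≤ lam ^ 2 * d.ρ r := by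
    intro r hr
    have h1 : d.g * deriv d.ρ r ≤ d.g * B :=
      mul_le_mul_of_nonneg_left (abs_le.1 (hB r hr)).2 hg.le
    have h2 : lam * d.ρ x = d.ρ x + d.g * B := by
      rw [hlam]; field_simp
    have h3 : d.ρ x ≤ d.ρ r := hmin hr
    have h4 : lam ≤ lam ^ 2 := by nlinarith
    have h5 : lam * d.ρ x ≤ lam ^ 2 * d.ρ r := mul_le_mul h4 h3 hm.le (by positivity)
    linarith
  have hle : d.g * d.buoyancy u ≤ lam ^ 2 * d.kinetic u v := by
    rw [buoyancy, kinetic, ← intervalIntegral.integral_const_mul,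
      ← intervalIntegral.integral_const_mul]
    refine intervalIntegral.integral_mono_on d.R₁_lt.le
      (Continuous.intervalIntegrable (by fun_prop) _ _)
      (Continuous.intervalIntegrable (by fun_prop) _ _) fun r hr => ?_
    have hr0 := d.pos_of_mem hr
    have h1 := mul_le_mul_of_nonneg_right (hkey r hr) (mul_nonneg hr0.le (sq_nonneg (u r)))
    have h2 : 0 ≤ lam ^ 2 * (r * d.ρ r * v r ^ 2) := by
      have := d.ρ_pos r hr
      positivity
    linarith
  have := mul_nonneg (by linarith : 0 ≤ lam) (d.dissipation_nonneg u v)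
  unfold energy
  linarith

lemma exists_admissible_buoyancy_pos (h : ∃ rs ∈ Ioo d.R₁ d.R₂, 0 < deriv d.ρ rs) :
    ∃ u v, d.Admissible u v ∧ 0 < d.buoyancy u := by
  obtain ⟨rs, hrs, hpos⟩ := h
  have hρ' := d.contDiff_deriv_ρ.continuous
  have hk := d.k_ne
  have hnhds : Ioo d.R₁ d.R₂ ∩ {r | 0 < deriv d.ρ r} ∈ nhds rs :=
    Filter.inter_mem (isOpen_Ioo.mem_nhds hrs)
      ((isOpen_lt continuous_const hρ').mem_nhds hpos)
  obtain ⟨φ, hsupp, -, hφ, -, hφ1⟩ := exists_contDiff_tsupport_subset (n := ⊤) hnhds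
  have hout : ∀ r, r ∉ Ioo d.R₁ d.R₂ ∩ {r | 0 < deriv d.ρ r} → φ r = 0 ∧ deriv φ r = 0 :=
    fun r hr => ⟨image_eq_zero_of_notMem_tsupport fun h => hr (hsupp h),
      Function.notMem_support.1 fun h => hr (hsupp (support_deriv_subset h))⟩
  have hleft := hout d.R₁ fun h => lt_irrefl _ h.1.1
  have hright := hout d.R₂ fun h => lt_irrefl _ h.1.2
  have hφ' : ContDiff ℝ (⊤ : ℕ∞) (deriv φ) := (contDiff_infty_iff_deriv.1 hφ).2
  refine ⟨φ, fun r => -(φ r + r * deriv φ r) / d.k, ⟨hφ, by fun_prop, fun r hr => ?_,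
    hleft.1, hright.1, by simp [hright.1, hright.2]⟩, ?_⟩
  · have := (d.pos_of_mem hr).ne'
    field_simp
    ring
  · have hφc := hφ.continuous
    refine intervalIntegral.integral_pos d.R₁_lt (Continuous.continuousOn (by fun_prop))
      (fun r hr => ?_) ⟨rs, Ioo_subset_Icc_self hrs, ?_⟩
    · by_cases h : r ∈ Ioo d.R₁ d.R₂ ∩ {r | 0 < deriv d.ρ r}
      · exact mul_nonneg (mul_nonneg (d.pos_of_mem (Ioc_subset_Icc_self hr)).le (le_of_lt h.2))
          (sq_nonneg _)
      · simp [(hout r h).1]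
    · rw [hφ1]
      have := d.pos_of_mem (Ioo_subset_Icc_self hrs)
      positivity

end FlowData

/-- A family of energies `lam² M + lam a - g N` that is positive for some parameter and indefinite
for another degenerates somewhere: the forced problems cannot all be solvable with bounds. -/
lemma exists_not_solvable {V : Type*} {M a N P : V → ℝ} {g : ℝ} (hg : 0 < g)
    (hM : ∀ v, 0 ≤ M v) (ha : ∀ v, 0 ≤ a v) (hP : ∀ v, 0 ≤ P v)
    (hN : ∃ C, 0 < C ∧ ∀ v, N v ≤ C * P v) (hNpos : ∃ v, 0 < N v)
    (hpos : ∃ lam, 0 < lam ∧ ∀ v, 0 ≤ lam ^ 2 * M v + lam * a v - g * N v) :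
    ∃ lam, 0 < lam ∧ ¬ ∃ C, ∀ w, ∃ Q, Q ≤ C * P w ∧ ∀ s : ℝ, ∃ v,
      lam ^ 2 * M v + lam * a v - g * N v =
        Q + 2 * s * (lam * P w) + s ^ 2 * (lam ^ 2 * M w + lam * a w - g * N w) := by
  set S : Set ℝ := {lam | 0 < lam ∧ ∀ v, 0 ≤ lam ^ 2 * M v + lam * a v - g * N v} with hS
  have hmono : ∀ v, ∀ x y : ℝ, 0 < x → x ≤ y → x ^ 2 * M v + x * a v ≤ y ^ 2 * M v + y * a v :=
    fun v x y hx hxy => add_le_add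
      (mul_le_mul_of_nonneg_right (pow_le_pow_left₀ hx.le hxy 2) (hM v))
      (mul_le_mul_of_nonneg_right hxy (ha v))
  obtain ⟨w, hw⟩ := hNpos
  obtain ⟨x, hx0, hx⟩ : ∃ x : ℝ, 0 < x ∧ x ^ 2 * M w + x * a w < g * N w := by
    have hMw := hM w
    have haw := ha w
    have hgN : 0 < g * N w := mul_pos hg hw
    set x := min 1 (g * N w / (M w + a w + 1))
    have hx0 : 0 < x := lt_min one_pos (by positivity)
    have hx1 : x ≤ 1 := min_le_left _ _
    have hx2 : x * (M w + a w + 1) ≤ g * N w := by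
      rw [← le_div_iff₀ (by positivity)]; exact min_le_right _ _
    refine ⟨x, hx0, ?_⟩
    have : x ^ 2 ≤ x := by nlinarith
    nlinarith [mul_le_mul_of_nonneg_right this hMw]
  have hlow : ∀ y ∈ S, x ≤ y := by
    intro y hy
    by_contra! hlt
    have := hmono w y x hy.1 hlt.le
    have := hy.2 w
    linarith
  have hbdd : BddBelow S := ⟨x, hlow⟩
  have hne : S.Nonempty := hpos
  set lam := sInf S
  have hlam : 0 < lam := hx0.trans_le (le_csInf hne hlow)
  have hmem : ∀ v, 0 ≤ lam ^ 2 * M v + lam * a v - g * N v := by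
    intro v
    have hcl : closure S ⊆ {y | 0 ≤ y ^ 2 * M v + y * a v - g * N v} :=
      closure_minimal (fun y hy => hy.2 v) (isClosed_le (by fun_prop) (by fun_prop))
    exact hcl (csInf_mem_closure hne hbdd)
  refine ⟨lam, hlam, ?_⟩
  rintro ⟨C, hC⟩
  obtain ⟨B, hB, hNB⟩ := hN
  set C' := max C 1
  have hC' : 0 < C' := lt_of_lt_of_le one_pos (le_max_right _ _)
  have hcoer : ∀ v, lam ^ 2 / C' * P v ≤ lam ^ 2 * M v + lam * a v - g * N v := by
    intro v
    obtain ⟨Q, hQ, hexp⟩ := hC v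
    set E := lam ^ 2 * M v + lam * a v - g * N v
    have hE : 0 ≤ E := hmem v
    have hdisc := discrim_le_zero (a := E) (b := 2 * (lam * P v)) (c := Q) fun s => by
      obtain ⟨u, hu⟩ := hexp s
      have := hmem u
      rw [hu] at this
      linarith
    rw [discrim] at hdisc
    rcases (hP v).eq_or_lt with h0 | h0
    · rw [← h0]; simpa using hE
    · have hQ' : Q ≤ C' * P v := hQ.trans (mul_le_mul_of_nonneg_right (le_max_left _ _) h0.le)
      have h1 : (lam ^ 2 * P v) * P v ≤ (C' * E) * P v := by
        linarith [mul_le_mul_of_nonneg_left hQ' hE]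
      rw [div_mul_eq_mul_div, div_le_iff₀ hC']
      linarith [le_of_mul_le_mul_right h1 h0]
  set c := lam ^ 2 / C' with hc
  have hc0 : 0 < c := by positivity
  set q := g * B / (c + g * B) with hq
  have hgB : 0 < g * B := mul_pos hg hB
  have hq0 : 0 < q := by positivity
  have hq1 : q < 1 := by rw [hq, div_lt_one (by positivity)]; linarith
  have hqc : q * (c + g * B) = g * B := by rw [hq]; field_simp
  set s := √q
  have hs0 : 0 < s := sqrt_pos.2 hq0
  have hs2 : s ^ 2 = q := sq_sqrt hq0.le
  have hs1 : s < 1 := by rw [← sqrt_one]; exact sqrt_lt_sqrt hq0.le hq1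
  have hmemS : s * lam ∈ S := by
    refine ⟨by positivity, fun v => ?_⟩
    have h1 := mul_le_mul_of_nonneg_left (hcoer v) hq0.le
    have h2 := mul_le_mul_of_nonneg_left (hNB v) (mul_nonneg hg.le (sub_nonneg.2 hq1.le))
    have h3 : q * (lam * a v) ≤ s * (lam * a v) := by
      refine mul_le_mul_of_nonneg_right ?_ (mul_nonneg hlam.le (ha v))
      rw [← hs2]; nlinarith
    rw [mul_pow, hs2]
    have h4 : q * (c * P v) = g * (1 - q) * (B * P v) := by linear_combination P v * hqc
    linarith
  have := csInf_le hbdd hmemS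
  nlinarith

theorem FlowData.exists_eigenmode (d : FlowData) (h : ∃ rs ∈ Ioo d.R₁ d.R₂, 0 < deriv d.ρ rs) :
    ∃ lam, 0 < lam ∧ ∃ y, d.IsSol lam (fun _ => 0) y ∧ d.BoundaryCond y ∧
      ∃ r ∈ Icc d.R₁ d.R₂, y r 0 ≠ 0 := by
  obtain ⟨B, hB, hNB⟩ := d.exists_buoyancy_le
  obtain ⟨Λ, hΛ, hΛpos⟩ := d.exists_energy_nonneg
  obtain ⟨u, v, huv, hpos⟩ := d.exists_admissible_buoyancy_pos h
  obtain ⟨lam, hlam, hno⟩ := exists_not_solvable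
    (V := {w : (ℝ → ℝ) × (ℝ → ℝ) // d.Admissible w.1 w.2})
    (M := fun w => d.kinetic w.1.1 w.1.2) (a := fun w => d.dissipation w.1.1 w.1.2)
    (N := fun w => d.buoyancy w.1.1) (P := fun w => d.mass w.1.1) d.g_pos
    (fun w => d.kinetic_nonneg _ _) (fun w => d.dissipation_nonneg _ _)
    (fun w => d.mass_nonneg _) ⟨B, hB, fun w => hNB _ w.2.smooth_fst⟩ ⟨⟨(u, v), huv⟩, hpos⟩
    ⟨Λ, hΛ, fun w => hΛpos _ _ w.2⟩
  refine ⟨lam, hlam, ?_⟩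
  by_contra! hcon
  refine hno ?_
  obtain ⟨C, hC⟩ := exists_competitor (d := d) hlam fun y hy hb =>
    hy.eq_zero_of_forall_eq_zero (hcon y hy hb)
  refine ⟨C, fun w => ?_⟩
  obtain ⟨a, b, hab, hexp, hle⟩ := hC _ _ w.2
  exact ⟨_, hle, fun s => ⟨⟨(_, _), hab.add_mul w.2 s⟩, hexp s⟩⟩

theorem statement16 (R₁ R₂ μ α g : ℝ) (hR₁ : 0 < R₁) (hR₁₂ : R₁ < R₂) (hμ : 0 < μ)
    (hg : 0 < g) (hα : 0 ≤ 1 - α * R₁ / μ) (ρ : ℝ → ℝ) (hρ : ContDiff ℝ (⊤ : ℕ∞) ρ)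
    (hρpos : ∀ r ∈ Icc R₁ R₂, 0 < ρ r)
    (hinst : ∃ rs ∈ Ioo R₁ R₂, 0 < deriv ρ rs)
    (k : ℤ) (hk : k ≠ 0) :
    ∃ lam : ℝ, 0 < lam ∧ ∃ w₁ w₂ h₁ h₂ : ℝ → ℝ,
      ContDiff ℝ (⊤ : ℕ∞) w₁ ∧ ContDiff ℝ (⊤ : ℕ∞) w₂ ∧
      ContDiff ℝ (⊤ : ℕ∞) h₁ ∧ ContDiff ℝ (⊤ : ℕ∞) h₂ ∧
      (∃ r ∈ Icc R₁ R₂, w₁ r ≠ 0) ∧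
      (∀ r ∈ Icc R₁ R₂,
        μ * (deriv (deriv w₁) r + (1 / r) * deriv w₁ r -
            (((k : ℝ) ^ 2 + 1) / r ^ 2) * w₁ r - lam * ρ r / μ * w₁ r) -
          (2 * μ * (k : ℝ) / r ^ 2) * w₂ r - deriv h₁ r - g * h₂ r = 0 ∧
        μ * (deriv (deriv w₂) r + (1 / r) * deriv w₂ r -
            (((k : ℝ) ^ 2 + 1) / r ^ 2) * w₂ r - lam * ρ r / μ * w₂ r) -
          (2 * μ * (k : ℝ) / r ^ 2) * w₁ r + ((k : ℝ) / r) * h₁ r = 0 ∧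
        lam * h₂ r = -(w₁ r * deriv ρ r) ∧
        (k : ℝ) * w₂ r = -deriv (fun x => x * w₁ x) r) ∧
      w₁ R₁ = 0 ∧ w₁ R₂ = 0 ∧ w₂ R₂ = 0 ∧
      deriv w₂ R₁ = (1 / R₁ - α / μ) * w₂ R₁ := by
  obtain ⟨J, hJs, hJ⟩ := exists_contDiff_eq_inv (half_pos hR₁)
  have hk' : (k : ℝ) ≠ 0 := by exact_mod_cast hk
  have hc : 0 ≤ 1 / R₁ - α / μ := by
    have : 1 / R₁ - α / μ = (1 - α * R₁ / μ) / R₁ := by field_simp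
    rw [this]
    positivity
  let d : FlowData := ⟨R₁, R₂, μ, 1 / R₁ - α / μ, g, k, ρ, J, hR₁, hR₁₂, hμ, hc, hg, hk', hρ,
    hρpos, hJs, hJ⟩
  obtain ⟨lam, hlam, y, hy, hb, hne⟩ := d.exists_eigenmode hinst
  have hz : ContDiff ℝ (⊤ : ℕ∞) fun _ : ℝ => (0 : ℝ) := contDiff_const
  have hs := hy.contDiff hz
  refine ⟨lam, hlam, fun r => y r 0, fun r => y r 1, fun r => y r 3,
    fun r => -(y r 0 * deriv ρ r) / lam, hs 0, hs 1, hs 3,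
    ((hs 0).mul d.contDiff_deriv_ρ).neg.div_const _, hne, fun r hr => ?_,
    hb.left_zero, hb.right_zero, hb.right_one, ?_⟩
  · have hr' : R₁ / 2 < r := d.half_lt hr
    have hr0 : r ≠ 0 := (d.pos_of_mem hr).ne'
    have hd1 : deriv (fun r => y r 1) = fun r => y r 2 :=
      funext fun r => (hy.hasDerivAt_one r).deriv
    have h0 := hy.hasDerivAt_zero r
    have hmul : deriv (fun x => x * y x 0) r = y r 0 + r * deriv (fun r => y r 0) r := by
      have := ((hasDerivAt_id' r).fun_mul h0).deriv
      rw [h0.deriv]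
      simpa using this
    have hJr : d.J r = r⁻¹ := hJ r hr'
    rw [hmul, hd1, (hy.hasDerivAt_deriv_zero hr').deriv, h0.deriv, (hy.hasDerivAt_two r).deriv,
      (hy.hasDerivAt_three r).deriv, hJr]
    have hdk : d.k = k := rfl
    have hdμ : d.μ = μ := rfl
    have hdg : d.g = g := rfl
    have hdρ : d.ρ = ρ := rfl
    rw [hdk, hdμ, hdg, hdρ]
    refine ⟨?_, ?_, ?_, ?_⟩
    · field_simp
      ring
    · field_simp
      ring
    · field_simp
    · field_simp
      ring
  · rw [(hy.hasDerivAt_one R₁).deriv]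
    exact hb.left_slip

end
end

section
/- Let T > 0 and let v_r, v_θ : [0,T] × [R₁,R₂] × ℝ → ℝ be continuous, 2π-periodic in θ, continuously differentiable in (r,θ) with spatial partial derivatives continuous jointly in (t,r,θ), and suppose that for every t ∈ [0,T]: ∂_r(r v_r) + ∂_θ v_θ = 0, v_r(t,R₁,θ) = v_r(t,R₂,θ) = 0, v_θ(t,R₂,θ) = 0, and ∂_r v_θ(t,R₁,θ) = (1/R₁ − α/μ) v_θ(t,R₁,θ) for all θ. Let ρ₀ : [R₁,R₂] × ℝ → ℝ be continuously differentiable and 2π-periodic in θ. Then there exists exactly one continuously differentiable function ρ : [0,T] × [R₁,R₂] × ℝ → ℝ, 2π-periodic in θ, satisfying the transport equation ∂_t ρ + v_r ∂_r ρ + (v_θ/r) ∂_θ ρ = 0 on [0,T] × [R₁,R₂] × ℝ together with ρ(0,·,·) = ρ₀. -/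
open Real MeasureTheory Set

noncomputable section

/-- Partial derivative in time. -/
def dt3 (u : ℝ → ℝ → ℝ → ℝ) (t r θ : ℝ) : ℝ := deriv (fun t' => u t' r θ) t

/-- Partial derivative in the radial variable. -/
def dr3 (u : ℝ → ℝ → ℝ → ℝ) (t r θ : ℝ) : ℝ := deriv (fun r' => u t r' θ) r

/-- Partial derivative in the angular variable. -/
def dq3 (u : ℝ → ℝ → ℝ → ℝ) (t r θ : ℝ) : ℝ := deriv (fun θ' => u t r θ') θ

/-- The polar Laplacian `Δ_r u = ∂_rr u + (1/r) ∂_r u + (1/r²) ∂_θθ u`. -/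
def lapR (u : ℝ → ℝ → ℝ → ℝ) (t r θ : ℝ) : ℝ :=
  dr3 (dr3 u) t r θ + (1 / r) * dr3 u t r θ + (1 / r ^ 2) * dq3 (dq3 u) t r θ

/-- Uncurrying a function of `(t, r, θ)`. -/
def u3 (u : ℝ → ℝ → ℝ → ℝ) : ℝ × ℝ × ℝ → ℝ := fun x => u x.1 x.2.1 x.2.2

/-- The space-time domain `[0,T] × [R₁,R₂] × ℝ`. -/
def dom3 (T R₁ R₂ : ℝ) : Set (ℝ × ℝ × ℝ) :=
  Icc (0:ℝ) T ×ˢ (Icc R₁ R₂ ×ˢ (univ : Set ℝ))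

/-- `u` is continuously differentiable on `[0,T] × [R₁,R₂] × ℝ`. -/
def C1On3 (T R₁ R₂ : ℝ) (u : ℝ → ℝ → ℝ → ℝ) : Prop :=
  (∀ t ∈ Icc (0:ℝ) T, ∀ r ∈ Icc R₁ R₂, ∀ θ : ℝ,
    DifferentiableAt ℝ (fun t' => u t' r θ) t ∧
    DifferentiableAt ℝ (fun r' => u t r' θ) r ∧
    DifferentiableAt ℝ (fun θ' => u t r θ') θ) ∧
  ContinuousOn (u3 u) (dom3 T R₁ R₂) ∧
  ContinuousOn (u3 (dt3 u)) (dom3 T R₁ R₂) ∧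
  ContinuousOn (u3 (dr3 u)) (dom3 T R₁ R₂) ∧
  ContinuousOn (u3 (dq3 u)) (dom3 T R₁ R₂)

section ODE

open Filter Topology

open scoped NNReal

variable {E : Type*} [NormedAddCommGroup E] [NormedSpace ℝ E]

lemma gronwallBound_le_mul {δ K ε x : ℝ} (hδ : 0 ≤ δ) (hK : 0 ≤ K) (hε : 0 ≤ ε) (hx : 0 ≤ x) :
    gronwallBound δ K ε x ≤ gronwallBound 1 K 1 x * (δ + ε) := by
  rcases hK.eq_or_lt with rfl | hK
  · simp only [gronwallBound_K0]
    nlinarith [mul_nonneg hδ hx]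
  · simp only [gronwallBound_of_K_ne_0 hK.ne']
    have h1 : 1 ≤ exp (K * x) := Real.one_le_exp (by positivity)
    have h2 : ε / K * (exp (K * x) - 1) = ε * (1 / K * (exp (K * x) - 1)) := by ring
    have h3 : 0 ≤ 1 / K * (exp (K * x) - 1) := mul_nonneg (by positivity) (by linarith)
    rw [h2]
    nlinarith [mul_nonneg hδ h3, mul_nonneg hε (exp_pos (K * x)).le]

/-- The constant in the two-sided Grönwall estimate on `[0, T]`. -/
def gronwallConst (K : ℝ≥0) (T : ℝ) : ℝ := gronwallBound 1 K 1 T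

lemma gronwallConst_nonneg (K : ℝ≥0) {T : ℝ} (hT : 0 ≤ T) : 0 ≤ gronwallConst K T := by
  have h := gronwallBound_mono (K := (K : ℝ)) zero_le_one zero_le_one K.2 hT
  rw [gronwallBound_x0] at h
  exact zero_le_one.trans h

lemma dist_le_of_approx_forward {v : ℝ → E → E} {K : ℝ≥0} (hv : ∀ s, LipschitzWith K (v s))
    {f g f' : ℝ → E} {a b T δ ε : ℝ} (hδ : 0 ≤ δ) (hε : 0 ≤ ε) (hab : b - a ≤ T)
    (hf : ∀ s ∈ Icc a b, HasDerivWithinAt f (f' s) (Icc a b) s)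
    (hf' : ∀ s ∈ Icc a b, dist (f' s) (v s (f s)) ≤ ε)
    (hg : ∀ s ∈ Icc a b, HasDerivWithinAt g (v s (g s)) (Icc a b) s)
    (h0 : dist (f a) (g a) ≤ δ) :
    ∀ s ∈ Icc a b, dist (f s) (g s) ≤ gronwallConst K T * (δ + ε) := by
  intro s hs
  have key := dist_le_of_approx_trajectories_ODE (εg := 0) hv
    (fun x hx => (hf x hx).continuousWithinAt)
    (fun x hx => (hf x (Ico_subset_Icc_self hx)).mono_of_mem_nhdsWithin (Icc_mem_nhdsGE_of_mem hx))
    (fun x hx => hf' x (Ico_subset_Icc_self hx))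
    (fun x hx => (hg x hx).continuousWithinAt)
    (fun x hx => (hg x (Ico_subset_Icc_self hx)).mono_of_mem_nhdsWithin (Icc_mem_nhdsGE_of_mem hx))
    (fun x hx => (dist_self _).le) h0 s hs
  rw [add_zero] at key
  have hT : 0 ≤ T := by linarith [hs.1, hs.2]
  refine key.trans ((gronwallBound_mono hδ hε K.2 ?_).trans (gronwallBound_le_mul hδ K.2 hε hT))
  linarith [hs.1, hs.2]

/-- Two-sided Grönwall estimate: on `[0, T]`, an approximate trajectory stays close to an exact
trajectory if they are close at some time `t`. -/
lemma dist_le_of_approx_Icc {v : ℝ → E → E} {K : ℝ≥0} (hv : ∀ s, LipschitzWith K (v s))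
    {f g f' : ℝ → E} {T δ ε t : ℝ} (hδ : 0 ≤ δ) (hε : 0 ≤ ε) (ht : t ∈ Icc 0 T)
    (hf : ∀ s ∈ Icc 0 T, HasDerivWithinAt f (f' s) (Icc 0 T) s)
    (hf' : ∀ s ∈ Icc 0 T, dist (f' s) (v s (f s)) ≤ ε)
    (hg : ∀ s ∈ Icc 0 T, HasDerivWithinAt g (v s (g s)) (Icc 0 T) s)
    (h0 : dist (f t) (g t) ≤ δ) :
    ∀ s ∈ Icc 0 T, dist (f s) (g s) ≤ gronwallConst K T * (δ + ε) := by
  intro s hs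
  rcases le_total t s with hts | hst
  · have hsub : Icc t T ⊆ Icc 0 T := Icc_subset_Icc_left ht.1
    exact dist_le_of_approx_forward hv hδ hε (by linarith [ht.1])
      (fun x hx => (hf x (hsub hx)).mono hsub) (fun x hx => hf' x (hsub hx))
      (fun x hx => (hg x (hsub hx)).mono hsub) h0 s ⟨hts, hs.2⟩
  · have hmaps : MapsTo (fun x : ℝ => -x) (Icc (-t) 0) (Icc 0 T) := by
      intro x hx
      simp only [mem_Icc] at hx ⊢
      constructor <;> linarith [ht.2, hx.1, hx.2]
    have hneg : ∀ x, HasDerivWithinAt (fun x : ℝ => -x) (-1) (Icc (-t) 0) x :=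
      fun x => (hasDerivAt_neg x).hasDerivWithinAt
    have key := dist_le_of_approx_forward (v := fun x y => -v (-x) y) (T := T)
      (f := fun x => f (-x)) (g := fun x => g (-x)) (f' := fun x => -f' (-x))
      (a := -t) (b := 0) (K := K) (fun x => (hv (-x)).neg) hδ hε (by linarith [ht.2])
      (fun x hx => by
        simpa [Function.comp_def] using (hf (-x) (hmaps hx)).scomp x (hneg x) hmaps)
      (fun x hx => by
        rw [dist_neg_neg]
        exact hf' (-x) (hmaps hx))
      (fun x hx => by
        simpa [Function.comp_def] using (hg (-x) (hmaps hx)).scomp x (hneg x) hmaps)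
      (by simpa using h0) (-s) ⟨by linarith, by linarith [hs.1]⟩
    simpa using key

lemma eqOn_Icc_of_trajectories {v : ℝ → E → E} {K : ℝ≥0} (hv : ∀ s, LipschitzWith K (v s))
    {f g : ℝ → E} {T t : ℝ} (ht : t ∈ Icc 0 T)
    (hf : ∀ s ∈ Icc 0 T, HasDerivWithinAt f (v s (f s)) (Icc 0 T) s)
    (hg : ∀ s ∈ Icc 0 T, HasDerivWithinAt g (v s (g s)) (Icc 0 T) s)
    (h0 : f t = g t) : ∀ s ∈ Icc 0 T, f s = g s := by
  intro s hs
  have := dist_le_of_approx_Icc hv le_rfl le_rfl ht hf (fun x _ => (dist_self _).le) hg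
    (dist_le_zero.2 h0) s hs
  rw [add_zero, mul_zero] at this
  exact dist_le_zero.1 this

/-- Truncation of a point of the plane to the square `[-M, M] ^ 2`. -/
def squareClamp (M : ℝ) (x : ℝ × ℝ) : ℝ × ℝ := (max (-M) (min M x.1), max (-M) (min M x.2))

lemma lipschitzWith_squareClamp (M : ℝ) : LipschitzWith 1 (squareClamp M) := by
  have h (f : ℝ × ℝ → ℝ) (hf : LipschitzWith 1 f) :
      LipschitzWith 1 fun x => max (-M) (min M (f x)) :=
    (hf.const_min M).const_max (-M)
  simpa using! (h _ LipschitzWith.prod_fst).prodMk (h _ LipschitzWith.prod_snd)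

lemma squareClamp_of_norm_le {M : ℝ} {x : ℝ × ℝ} (hx : ‖x‖ ≤ M) : squareClamp M x = x := by
  rw [Prod.norm_def, max_le_iff, Real.norm_eq_abs, Real.norm_eq_abs, abs_le, abs_le] at hx
  simp [squareClamp, hx]

lemma norm_squareClamp_le {M : ℝ} (hM : 0 ≤ M) (x : ℝ × ℝ) : ‖squareClamp M x‖ ≤ M := by
  rw [Prod.norm_def, max_le_iff, Real.norm_eq_abs, Real.norm_eq_abs, abs_le, abs_le]
  simp [squareClamp, hM]

/-- Global existence for a planar ODE with continuous right-hand side, globally Lipschitz in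
space. -/
lemma exists_trajectory_Icc {v : ℝ → ℝ × ℝ → ℝ × ℝ} {K : ℝ≥0} (hv : ∀ s, LipschitzWith K (v s))
    (hc : Continuous (Function.uncurry v)) {T t : ℝ} (ht : t ∈ Icc 0 T) (x : ℝ × ℝ) :
    ∃ f : ℝ → ℝ × ℝ, f t = x ∧ ∀ s ∈ Icc 0 T, HasDerivWithinAt f (v s (f s)) (Icc 0 T) s := by
  have hT : 0 ≤ T := ht.1.trans ht.2
  obtain ⟨B, hB⟩ := (isCompact_Icc (a := (0 : ℝ)) (b := T)).exists_bound_of_continuousOn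
    (f := fun s => v s 0) (hc.comp (by fun_prop : Continuous fun s : ℝ => (s, (0 : ℝ × ℝ)))).continuousOn
  have hB0 : 0 ≤ B := (norm_nonneg _).trans (hB 0 ⟨le_rfl, hT⟩)
  set M : ℝ := gronwallConst K T * (‖x‖ + B) with hMdef
  have hM : 0 ≤ M := mul_nonneg (gronwallConst_nonneg K hT) (by positivity)
  set F : ℝ → ℝ × ℝ → ℝ × ℝ := fun s y => v s (squareClamp M y) with hF
  have hFlip : ∀ s, LipschitzWith K (F s) := fun s => by
    simpa using! (hv s).comp (lipschitzWith_squareClamp M)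
  have hFbound : ∀ s ∈ Icc 0 T, ∀ y, ‖F s y‖ ≤ K * M + B := fun s hs y => by
    have h1 := (hv s).dist_le_mul (squareClamp M y) 0
    rw [dist_eq_norm, dist_zero_right] at h1
    have h2 := mul_le_mul_of_nonneg_left (norm_squareClamp_le hM y) K.2
    calc ‖F s y‖ ≤ ‖F s y - v s 0‖ + ‖v s 0‖ := by
          simpa using norm_add_le (F s y - v s 0) (v s 0)
      _ ≤ K * M + B := add_le_add (h1.trans h2) (hB s hs)
  have hPL : IsPicardLindelof F (⟨t, ht⟩ : Icc 0 T) x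
      (Real.toNNReal ((K * M + B) * T)) 0 (Real.toNNReal (K * M + B)) K :=
    { lipschitzOnWith := fun s _ => (hFlip s).lipschitzOnWith
      continuousOn := fun y _ =>
        (hc.comp (by fun_prop : Continuous fun s : ℝ => (s, squareClamp M y))).continuousOn
      norm_le := fun s hs y _ => (hFbound s hs y).trans (Real.le_coe_toNNReal _)
      mul_max_le := by
        have h : 0 ≤ K * M + B := by positivity
        rw [Real.coe_toNNReal _ h, Real.coe_toNNReal _ (mul_nonneg h hT), NNReal.coe_zero,
          sub_zero, sub_zero]
        refine mul_le_mul_of_nonneg_left (max_le ?_ ?_) h <;> simp [ht.1, ht.2] }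
  obtain ⟨f, hft, hf⟩ := hPL.exists_eq_forall_mem_Icc_hasDerivWithinAt₀
  refine ⟨f, hft, fun s hs => ?_⟩
  have hbd := dist_le_of_approx_Icc (f := fun _ => 0) (f' := fun _ => 0) (δ := ‖x‖) hFlip
    (norm_nonneg _) hB0 ht
    (fun s _ => hasDerivWithinAt_const _ _ _)
    (fun s hs => by
      rw [dist_zero_left, hF]
      simpa only [squareClamp_of_norm_le (norm_zero.le.trans hM)] using hB s hs)
    hf (by rw [dist_zero_left]; exact (congrArg norm hft).le) s hs
  rw [dist_zero_left, ← hMdef] at hbd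
  simpa only [hF, squareClamp_of_norm_le hbd] using hf s hs

/-- Clamping of a real number to the interval `[a, b]`. -/
def clampIcc {a b : ℝ} (h : a ≤ b) (s : ℝ) : ℝ := projIcc a b h s

lemma continuous_clampIcc {a b : ℝ} (h : a ≤ b) : Continuous (clampIcc h) :=
  continuous_subtype_val.comp continuous_projIcc

lemma clampIcc_mem {a b : ℝ} (h : a ≤ b) (s : ℝ) : clampIcc h s ∈ Icc a b := (projIcc a b h s).2

lemma clampIcc_of_mem {a b : ℝ} (h : a ≤ b) {s : ℝ} (hs : s ∈ Icc a b) : clampIcc h s = s := by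
  rw [clampIcc, projIcc_of_mem h hs]

/-- Continuous dependence of trajectories on parameters. -/
lemma continuous_trajectory_param {P : Type*} [TopologicalSpace P] {F : P → ℝ → E → E} {K : ℝ≥0}
    (hF : ∀ p s, LipschitzWith K (F p s))
    (hc : Continuous fun q : P × ℝ × E => F q.1 q.2.1 q.2.2) {T : ℝ} (hT : 0 ≤ T)
    {y : P → ℝ → E} (hy : ∀ p, ∀ s ∈ Icc 0 T, HasDerivWithinAt (y p) (F p s (y p s)) (Icc 0 T) s)
    {τ : P → ℝ} (hτ : Continuous τ) (hτT : ∀ p, τ p ∈ Icc 0 T)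
    (h0 : Continuous fun p => y p (τ p)) :
    Continuous fun q : P × ℝ => y q.1 (clampIcc hT q.2) := by
  have hycont : ∀ p, Continuous fun s => y p (clampIcc hT s) := fun p =>
    (show ContinuousOn (y p) (Icc 0 T) from fun s hs => (hy p s hs).continuousWithinAt).comp_continuous
      (continuous_clampIcc hT) (clampIcc_mem hT)
  rw [continuous_iff_continuousAt]
  rintro ⟨p₀, s₀⟩
  rw [Metric.continuousAt_iff']
  intro ε hε
  set C := gronwallConst K T
  have hC : 0 ≤ C := gronwallConst_nonneg K hT
  obtain ⟨η, hη, hCη⟩ : ∃ η > 0, C * (η + η) ≤ ε / 2 := by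
    refine ⟨ε / (4 * (C + 1)), by positivity, ?_⟩
    rw [← two_mul, ← mul_assoc, mul_div_assoc', div_le_iff₀ (by positivity)]
    nlinarith
  have h1 : ∀ᶠ p in 𝓝 p₀, ∀ s ∈ Icc 0 T,
      dist (F p₀ s (y p₀ (clampIcc hT s))) (F p s (y p₀ (clampIcc hT s))) < η := by
    refine isCompact_Icc.eventually_forall_of_forall_eventually fun s _ => ?_
    have hcont : Continuous fun q : P × ℝ =>
        dist (F p₀ q.2 (y p₀ (clampIcc hT q.2))) (F q.1 q.2 (y p₀ (clampIcc hT q.2))) := by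
      have hy' : Continuous fun q : P × ℝ => y p₀ (clampIcc hT q.2) :=
        (hycont p₀).comp continuous_snd
      exact (hc.comp (continuous_const.prodMk (continuous_snd.prodMk hy'))).dist
        (hc.comp (continuous_fst.prodMk (continuous_snd.prodMk hy')))
    refine hcont.continuousAt.eventually_lt continuousAt_const ?_
    simpa using hη
  have h2 : ∀ᶠ p in 𝓝 p₀, dist (y p₀ (τ p)) (y p (τ p)) < η := by
    have hcont : Continuous fun p => dist (y p₀ (clampIcc hT (τ p))) (y p (τ p)) :=
      ((hycont p₀).comp hτ).dist h0
    have := hcont.continuousAt.eventually_lt (continuousAt_const (x := p₀) (y := η))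
      (by simpa [clampIcc_of_mem hT (hτT p₀)] using hη)
    filter_upwards [this] with p hp
    rwa [clampIcc_of_mem hT (hτT p)] at hp
  have h3 : ∀ᶠ s in 𝓝 s₀, dist (y p₀ (clampIcc hT s)) (y p₀ (clampIcc hT s₀)) < ε / 2 :=
    Metric.continuousAt_iff'.1 (hycont p₀).continuousAt _ (half_pos hε)
  filter_upwards [(h1.and h2).prod_nhds h3] with ⟨p, s⟩ ⟨⟨hp1, hp2⟩, hs⟩
  have key := dist_le_of_approx_Icc (hF p) hη.le hη.le (hτT p) (hy p₀)
    (fun x hx => by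
      have := (hp1 x hx).le
      rwa [clampIcc_of_mem hT hx] at this)
    (hy p) hp2.le _ (clampIcc_mem hT s)
  calc dist (y p (clampIcc hT s)) (y p₀ (clampIcc hT s₀))
      ≤ dist (y p (clampIcc hT s)) (y p₀ (clampIcc hT s))
        + dist (y p₀ (clampIcc hT s)) (y p₀ (clampIcc hT s₀)) := dist_triangle _ _ _
    _ < ε / 2 + ε / 2 := add_lt_add_of_le_of_lt (by rw [dist_comm]; exact key.trans hCη) hs
    _ = ε := add_halves ε

/-- A uniform first-order Taylor estimate along a compact arc `γ` for a time-dependent map which is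
differentiable within a convex set. -/
lemma eventually_taylor_along_arc {F : Type*} [NormedAddCommGroup F] [NormedSpace ℝ F]
    {v : ℝ → E → F} {A : ℝ → E → E →L[ℝ] F} {S : Set E} (hS : Convex ℝ S)
    (hvA : ∀ s, ∀ x ∈ S, HasFDerivWithinAt (v s) (A s x) S x)
    (hA : Continuous fun q : ℝ × E => A q.1 q.2) {γ : ℝ → E} {T : ℝ}
    (hγ : ContinuousOn γ (Icc 0 T)) (hγS : ∀ s ∈ Icc 0 T, γ s ∈ S) {η : ℝ} (hη : 0 < η) :
    ∃ r > 0, ∀ s ∈ Icc 0 T, ∀ z ∈ S, ‖z - γ s‖ ≤ r →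
      ‖v s z - v s (γ s) - A s (γ s) (z - γ s)‖ ≤ η * ‖z - γ s‖ := by
  have h1 : ∀ᶠ h in 𝓝 (0 : E), ∀ s ∈ Icc 0 T, dist (A s (γ s + h)) (A s (γ s)) < η := by
    have hγ' : ContinuousOn (fun q : E × ℝ => γ q.2) (univ ×ˢ Icc 0 T) :=
      hγ.comp continuousOn_snd fun q hq => hq.2
    have hA₁ : ContinuousOn (fun q : E × ℝ => A q.2 (γ q.2 + q.1)) (univ ×ˢ Icc 0 T) :=
      hA.comp_continuousOn (continuousOn_snd.prodMk (hγ'.add continuousOn_fst))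
    have hA₂ : ContinuousOn (fun q : E × ℝ => A q.2 (γ q.2)) (univ ×ˢ Icc 0 T) :=
      hA.comp_continuousOn (continuousOn_snd.prodMk hγ')
    have hcont := continuous_dist.comp_continuousOn (hA₁.prodMk hA₂)
    have key := (isCompact_Icc (a := (0 : ℝ)) (b := T)).eventually_forall_of_forall_eventually
      (x₀ := (0 : E)) (P := fun h s => s ∈ Icc 0 T → dist (A s (γ s + h)) (A s (γ s)) < η)
      fun s hs => by
        have := (hcont (0, s) ⟨mem_univ _, hs⟩).eventually_lt continuousWithinAt_const
          (g := fun _ => η) (by simpa using hη)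
        rw [eventually_nhdsWithin_iff] at this
        filter_upwards [this] with q hq hqT using hq ⟨mem_univ _, hqT⟩
    filter_upwards [key] with h hh s hs using hh s hs hs
  obtain ⟨r, hr, hball⟩ := Metric.nhds_basis_closedBall.eventually_iff.1 h1
  refine ⟨r, hr, fun s hs z hz hzr => ?_⟩
  refine Convex.norm_image_sub_le_of_norm_hasFDerivWithin_le' (s := S ∩ Metric.closedBall (γ s) r)
    (f' := A s) (fun x hx => (hvA s x hx.1).mono inter_subset_left) (fun x hx => ?_)
    (hS.inter (convex_closedBall _ _)) ⟨hγS s hs, Metric.mem_closedBall_self hr.le⟩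
    ⟨hz, by rwa [mem_closedBall_iff_norm]⟩
  have := (hball (x := x - γ s) (by
    rw [mem_closedBall_zero_iff, ← mem_closedBall_iff_norm]; exact hx.2) s hs).le
  rwa [add_sub_cancel, dist_eq_norm] at this

/-- The linear endomorphism of the plane with the given columns. -/
def ofColumns {F : Type*} [NormedAddCommGroup F] [NormedSpace ℝ F] (a b : F) : ℝ × ℝ →L[ℝ] F :=
  (ContinuousLinearMap.fst ℝ ℝ ℝ).smulRight a + (ContinuousLinearMap.snd ℝ ℝ ℝ).smulRight b

@[simp]
lemma ofColumns_apply {F : Type*} [NormedAddCommGroup F] [NormedSpace ℝ F] (a b : F) (h : ℝ × ℝ) :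
    ofColumns a b h = h.1 • a + h.2 • b := rfl

lemma continuous_ofColumns {F : Type*} [NormedAddCommGroup F] [NormedSpace ℝ F] :
    Continuous fun q : F × F => ofColumns q.1 q.2 :=
  ((ContinuousLinearMap.smulRightL ℝ (ℝ × ℝ) F (ContinuousLinearMap.fst ℝ ℝ ℝ)).continuous.comp
    continuous_fst).add
  ((ContinuousLinearMap.smulRightL ℝ (ℝ × ℝ) F (ContinuousLinearMap.snd ℝ ℝ ℝ)).continuous.comp
    continuous_snd)

/-- The flow of a planar vector field that is `C¹` within an invariant convex set is differentiable
within this set with respect to the initial point; its derivative solves the linearized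
equation. -/
lemma hasFDerivWithinAt_flow {v : ℝ → ℝ × ℝ → ℝ × ℝ} {K : ℝ≥0} (hv : ∀ s, LipschitzWith K (v s))
    {A : ℝ → ℝ × ℝ → ℝ × ℝ →L[ℝ] ℝ × ℝ} {S : Set (ℝ × ℝ)} (hS : Convex ℝ S)
    (hvA : ∀ s, ∀ x ∈ S, HasFDerivWithinAt (v s) (A s x) S x)
    (hA : Continuous fun q : ℝ × ℝ × ℝ => A q.1 q.2) (hAK : ∀ s x, ‖A s x‖ ≤ K)
    {T t : ℝ} (ht : t ∈ Icc 0 T) {Φ : ℝ × ℝ → ℝ → ℝ × ℝ}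
    (hΦ : ∀ x, ∀ s ∈ Icc 0 T, HasDerivWithinAt (Φ x) (v s (Φ x s)) (Icc 0 T) s)
    (hΦt : ∀ x, Φ x t = x) (hΦS : ∀ x ∈ S, ∀ s ∈ Icc 0 T, Φ x s ∈ S)
    {x : ℝ × ℝ} (hx : x ∈ S) {w₁ w₂ : ℝ → ℝ × ℝ}
    (hw₁ : ∀ s ∈ Icc 0 T, HasDerivWithinAt w₁ (A s (Φ x s) (w₁ s)) (Icc 0 T) s)
    (hw₂ : ∀ s ∈ Icc 0 T, HasDerivWithinAt w₂ (A s (Φ x s) (w₂ s)) (Icc 0 T) s)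
    (hw₁t : w₁ t = (1, 0)) (hw₂t : w₂ t = (0, 1)) {s : ℝ} (hs : s ∈ Icc 0 T) :
    HasFDerivWithinAt (fun x => Φ x s) (ofColumns (w₁ s) (w₂ s)) S x := by
  have hT : 0 ≤ T := ht.1.trans ht.2
  set C := gronwallConst K T
  have hC : 0 ≤ C := gronwallConst_nonneg K hT
  have hlip : ∀ y, ∀ s ∈ Icc 0 T, ‖Φ y s - Φ x s‖ ≤ C * ‖y - x‖ := fun y s hs => by
    have := dist_le_of_approx_Icc hv (norm_nonneg (y - x)) le_rfl ht (hΦ y)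
      (fun _ _ => (dist_self _).le) (hΦ x) (by rw [hΦt, hΦt, dist_eq_norm]) s hs
    rwa [add_zero, dist_eq_norm] at this
  refine .of_isLittleO (Asymptotics.isLittleO_iff.2 fun c hc => ?_)
  obtain ⟨η, hη, hCη⟩ : ∃ η > 0, C * (η * C) ≤ c := by
    refine ⟨c / (C * C + 1), by positivity, ?_⟩
    rw [div_mul_eq_mul_div, mul_div_assoc', div_le_iff₀ (by positivity)]
    nlinarith
  obtain ⟨r, hr, htaylor⟩ := eventually_taylor_along_arc hS hvA hA
    (fun s hs => (hΦ x s hs).continuousWithinAt) (hΦS x hx) hη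
  have hnear : ∀ᶠ y in 𝓝[S] x, C * ‖y - x‖ < r := by
    have hcont : Continuous fun y => C * ‖y - x‖ := by fun_prop
    exact (hcont.continuousAt.eventually_lt continuousAt_const
      (by simpa using hr)).filter_mono nhdsWithin_le_nhds
  filter_upwards [hnear, self_mem_nhdsWithin] with y hy hyS
  set h := y - x
  have key := dist_le_of_approx_Icc (v := fun s z => A s (Φ x s) z) (K := K) (δ := 0)
    (f := fun s => Φ y s - Φ x s) (f' := fun s => v s (Φ y s) - v s (Φ x s))
    (g := fun s => ofColumns (w₁ s) (w₂ s) h) (ε := η * (C * ‖h‖)) (T := T) (t := t)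
    (fun s => ((A s (Φ x s)).lipschitz.weaken (hAK s _))) le_rfl (by positivity) ht
    (fun s hs => (hΦ y s hs).sub (hΦ x s hs))
    (fun s hs => by
      rw [dist_eq_norm]
      have hd := hlip y s hs
      refine (htaylor s hs _ (hΦS y hyS s hs) (hd.trans hy.le)).trans ?_
      gcongr)
    (fun s hs => by
      simpa using! ((hw₁ s hs).const_smul h.1).add ((hw₂ s hs).const_smul h.2))
    (by simp [hΦt, hw₁t, hw₂t, h, Prod.dist_eq]) s hs
  rw [dist_eq_norm, zero_add] at key
  refine key.trans ?_
  rw [← mul_assoc, ← mul_assoc, mul_assoc C]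
  gcongr

/-- First-order expansion of a family `f χ` of functions between two points `w χ` and `v χ` which
tend to the same limit, when the derivatives converge there. -/
lemma isLittleO_sub_sub_of_hasFDerivWithinAt {α F : Type*} [NormedAddCommGroup F] [NormedSpace ℝ F]
    {u : E} {l : Filter α} {v w : α → E} (hv : Tendsto v l (𝓝 u)) (hw : Tendsto w l (𝓝 u))
    (s : Set E) (seg : ∀ᶠ χ in l, segment ℝ (w χ) (v χ) ⊆ s)
    {f : α → E → F} {f' : α → E → E →L[ℝ] F}
    (df' : ∀ᶠ p in l ×ˢ 𝓝[s] u, HasFDerivWithinAt (f p.1) (f' p.1 p.2) s p.2)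
    {φ : E →L[ℝ] F} (cf' : Tendsto (fun p : α × E => f' p.1 p.2) (l ×ˢ 𝓝[s] u) (𝓝 φ)) :
    (fun χ => f χ (v χ) - f χ (w χ) - φ (v χ - w χ)) =o[l] (fun χ => v χ - w χ) := by
  rw [Asymptotics.isLittleO_iff]
  intro ε hε
  have df'' : ∀ᶠ χ in l, ∀ z ∈ segment ℝ (w χ) (v χ), HasFDerivWithinAt (f χ) (f' χ z) s z :=
    df'.segment_of_prod_nhdsWithin hw hv seg
  have cf'' : ∀ᶠ χ in l, ∀ z ∈ segment ℝ (w χ) (v χ), ‖f' χ z - φ‖ < ε := by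
    simp_rw [Metric.tendsto_nhds, dist_eq_norm_sub] at cf'
    exact (cf' ε hε).segment_of_prod_nhdsWithin hw hv seg
  filter_upwards [seg, df'', cf''] with χ seg df' cf'
  exact Convex.norm_image_sub_le_of_norm_hasFDerivWithin_le'
    (fun z hz => (df' z hz).mono seg) (fun z hz => (cf' z hz).le)
    (convex_segment ..) (left_mem_segment ..) (right_mem_segment ..)

/-- Product rule for the partial variation of `f` in space along a curve. -/
lemma hasDerivWithinAt_sub_along_curve {f : ℝ → E → ℝ} {f' : ℝ → E → E →L[ℝ] ℝ} {I : Set ℝ}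
    {S : Set E} (hS : Convex ℝ S) (hf : ∀ s ∈ I, ∀ x ∈ S, HasFDerivWithinAt (f s) (f' s x) S x)
    (hf' : ContinuousOn (fun q : ℝ × E => f' q.1 q.2) (I ×ˢ S)) {u : ℝ → E} {u' : E} {t : ℝ}
    (ht : t ∈ I) (hu : HasDerivWithinAt u u' I t) (huS : ∀ s ∈ I, u s ∈ S) :
    HasDerivWithinAt (fun s => f s (u s) - f s (u t)) (f' t (u t) u') I t := by
  have hmem : ∀ᶠ s in 𝓝[I] t, s ∈ I := self_mem_nhdsWithin
  have hlo := isLittleO_sub_sub_of_hasFDerivWithinAt (l := 𝓝[I] t) (u := u t) (v := u)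
    (w := fun _ => u t) hu.continuousWithinAt tendsto_const_nhds S
    (by filter_upwards [hmem] with s hs using hS.segment_subset (huS t ht) (huS s hs))
    (f := f) (f' := f')
    (by
      filter_upwards [hmem.prod_mk (self_mem_nhdsWithin : S ∈ 𝓝[S] u t)] with p hp
        using hf _ hp.1 _ hp.2)
    (φ := f' t (u t))
    (by
      have := hf' (t, u t) ⟨ht, huS t ht⟩
      rwa [ContinuousWithinAt, nhdsWithin_prod_eq] at this)
  have hlin := (f' t (u t)).hasFDerivAt.comp_hasDerivWithinAt t hu
  rw [hasDerivWithinAt_iff_isLittleO] at hlin ⊢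
  have hO : (fun s => u s - u t) =O[𝓝[I] t] fun s => s - t :=
    hu.hasFDerivWithinAt.isBigO_sub
  refine ((hlo.trans_isBigO hO).add hlin).congr_left fun s => ?_
  simp only [Function.comp_apply, map_sub]
  abel

/-- A function on a strip with continuous radial derivative and an angular derivative is
differentiable within the strip. -/
lemma hasFDerivWithinAt_strip_of_partial {f fr fθ : ℝ → ℝ → ℝ} {I : Set ℝ} (hI : Convex ℝ I)
    (hr : ∀ r ∈ I, ∀ θ, HasDerivWithinAt (fun r' => f r' θ) (fr r θ) I r)
    (hθ : ∀ r ∈ I, ∀ θ, HasDerivAt (fun θ' => f r θ') (fθ r θ) θ)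
    (hfr : ContinuousOn (fun q : ℝ × ℝ => fr q.1 q.2) (I ×ˢ univ)) {x : ℝ × ℝ} (hx : x.1 ∈ I) :
    HasFDerivWithinAt (fun q : ℝ × ℝ => f q.1 q.2) (ofColumns (fr x.1 x.2) (fθ x.1 x.2))
      (I ×ˢ univ) x := by
  have hmem : ∀ᶠ q in 𝓝[I ×ˢ univ] x, q.1 ∈ I :=
    eventually_mem_nhdsWithin.mono fun q hq => hq.1
  have hfst : Tendsto Prod.fst (𝓝[I ×ˢ univ] x) (𝓝 x.1) :=
    continuous_fst.continuousAt.mono_left nhdsWithin_le_nhds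
  have hsnd : Tendsto Prod.snd (𝓝[I ×ˢ univ] x) (𝓝 x.2) :=
    continuous_snd.continuousAt.mono_left nhdsWithin_le_nhds
  have h1 := isLittleO_sub_sub_of_hasFDerivWithinAt (l := 𝓝[I ×ˢ univ] x) (u := x.1) (v := Prod.fst)
    (w := fun _ => x.1) hfst tendsto_const_nhds I
    (by filter_upwards [hmem] with s hs using hI.segment_subset hx hs)
    (f := fun q r => f r q.2) (f' := fun q r => ContinuousLinearMap.toSpanSingleton ℝ (fr r q.2))
    (by
      filter_upwards [hmem.prod_mk (self_mem_nhdsWithin : I ∈ 𝓝[I] x.1)] with p hp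
        using (hr _ hp.2 _).hasFDerivWithinAt)
    (φ := ContinuousLinearMap.toSpanSingleton ℝ (fr x.1 x.2))
    (by
      have hc : Tendsto (fun p : (ℝ × ℝ) × ℝ => (p.2, p.1.2)) (𝓝[I ×ˢ univ] x ×ˢ 𝓝[I] x.1)
          (𝓝[I ×ˢ univ] x) := by
        rw [show x = (x.1, x.2) from rfl, nhdsWithin_prod_eq, nhdsWithin_univ]
        exact tendsto_snd.prodMk (tendsto_snd.comp tendsto_fst)
      exact ((ContinuousLinearMap.toSpanSingletonCLE (𝕜 := ℝ) (E := ℝ)).continuous.tendsto _).comp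
        ((hfr x ⟨hx, mem_univ _⟩).tendsto.comp hc))
  have h2 := (hasDerivAt_iff_isLittleO.1 (hθ x.1 hx x.2)).comp_tendsto hsnd
  have hb1 : (fun q : ℝ × ℝ => q.1 - x.1) =O[𝓝[I ×ˢ univ] x] fun q => q - x :=
    Asymptotics.isBigO_of_le _ fun q => norm_fst_le (q - x)
  have hb2 : (fun q : ℝ × ℝ => q.2 - x.2) =O[𝓝[I ×ˢ univ] x] fun q => q - x :=
    Asymptotics.isBigO_of_le _ fun q => norm_snd_le (q - x)
  refine .of_isLittleO (((h1.trans_isBigO hb1).add (h2.trans_isBigO hb2)).congr_left fun q => ?_)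
  simp
  ring

/-- `u` is a trajectory of the time-dependent vector field `v` on `[0, T]`. -/
def IsTrajectory (v : ℝ → E → E) (T : ℝ) (u : ℝ → E) : Prop :=
  ∀ s ∈ Icc 0 T, HasDerivWithinAt u (v s (u s)) (Icc 0 T) s

/-- Transporting a `C¹` function along the trajectories of a planar vector field which is `C¹`
within an invariant convex set gives a function with continuous spatial derivative. -/
lemma exists_transported {v : ℝ → ℝ × ℝ → ℝ × ℝ} {K : ℝ≥0} (hv : ∀ s, LipschitzWith K (v s))
    (hvc : Continuous (Function.uncurry v))
    {A : ℝ → ℝ × ℝ → ℝ × ℝ →L[ℝ] ℝ × ℝ} {S : Set (ℝ × ℝ)} (hS : Convex ℝ S)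
    (hvA : ∀ s, ∀ x ∈ S, HasFDerivWithinAt (v s) (A s x) S x)
    (hA : Continuous fun q : ℝ × ℝ × ℝ => A q.1 q.2) (hAK : ∀ s x, ‖A s x‖ ≤ K)
    {T : ℝ} (hT : 0 ≤ T)
    (hinv : ∀ u, IsTrajectory v T u → ∀ t ∈ Icc 0 T, u t ∈ S → ∀ s ∈ Icc 0 T, u s ∈ S)
    {g₀ : ℝ × ℝ → ℝ} (hg₀ : ContDiff ℝ 1 g₀) :
    ∃ (g : ℝ → ℝ × ℝ → ℝ) (g' : ℝ → ℝ × ℝ → ℝ × ℝ →L[ℝ] ℝ),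
      (Continuous fun q : ℝ × ℝ × ℝ => g q.1 q.2) ∧
      (Continuous fun q : ℝ × ℝ × ℝ => g' q.1 q.2) ∧
      (∀ t ∈ Icc 0 T, ∀ x ∈ S, HasFDerivWithinAt (g t) (g' t x) S x) ∧
      ∀ u, IsTrajectory v T u → ∀ t ∈ Icc 0 T, g t (u t) = g₀ (u 0) := by
  have h0 : (0 : ℝ) ∈ Icc 0 T := ⟨le_rfl, hT⟩
  choose Φ hΦt hΦ using fun p : ℝ × ℝ × ℝ =>
    exists_trajectory_Icc hv hvc (clampIcc_mem hT p.1) p.2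
  have hΦc : Continuous fun q : (ℝ × ℝ × ℝ) × ℝ => Φ q.1 (clampIcc hT q.2) :=
    continuous_trajectory_param (F := fun _ => v) (fun _ => hv) (hvc.comp continuous_snd) hT hΦ
      ((continuous_clampIcc hT).comp continuous_fst) (fun p => clampIcc_mem hT p.1)
      (by simpa only [Function.comp_apply, hΦt] using continuous_snd)
  set B : ℝ × ℝ × ℝ → ℝ → ℝ × ℝ → ℝ × ℝ := fun p s w => A s (Φ p (clampIcc hT s)) w with hB
  have hBlip : ∀ p s, LipschitzWith K (B p s) := fun p s => (A s _).lipschitz.weaken (hAK s _)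
  have hBc : Continuous fun q : (ℝ × ℝ × ℝ) × ℝ × ℝ × ℝ => B q.1 q.2.1 q.2.2 := by
    have h1 : Continuous fun q : (ℝ × ℝ × ℝ) × ℝ × ℝ × ℝ => Φ q.1 (clampIcc hT q.2.1) :=
      hΦc.comp (continuous_fst.prodMk (continuous_fst.comp continuous_snd))
    exact (hA.comp ((continuous_fst.comp continuous_snd).prodMk h1)).clm_apply
      (continuous_snd.comp continuous_snd)
  choose W hWt hW using fun (e : ℝ × ℝ) (p : ℝ × ℝ × ℝ) =>
    exists_trajectory_Icc (hBlip p) (hBc.comp (Continuous.prodMk_right p)) (clampIcc_mem hT p.1) e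
  have hWc : ∀ e, Continuous fun p : ℝ × ℝ × ℝ => W e p 0 := fun e => by
    have := continuous_trajectory_param hBlip hBc hT (hW e)
      ((continuous_clampIcc hT).comp continuous_fst) (fun p => clampIcc_mem hT p.1)
      (by simpa only [Function.comp_apply, hWt] using continuous_const)
    simpa only [Function.comp_def, clampIcc_of_mem hT h0] using
      this.comp (Continuous.prodMk_left (0 : ℝ))
  have hΦ0c : Continuous fun p : ℝ × ℝ × ℝ => Φ p 0 := by
    simpa only [Function.comp_def, clampIcc_of_mem hT h0] using
      hΦc.comp (Continuous.prodMk_left (0 : ℝ))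
  refine ⟨fun t x => g₀ (Φ (t, x) 0), fun t x => (fderiv ℝ g₀ (Φ (t, x) 0)).comp
    (ofColumns (W (1, 0) (t, x) 0) (W (0, 1) (t, x) 0)), hg₀.continuous.comp hΦ0c, ?_, ?_, ?_⟩
  · exact ((hg₀.continuous_fderiv one_ne_zero).comp hΦ0c).clm_comp
      (continuous_ofColumns.comp ((hWc (1, 0)).prodMk (hWc (0, 1))))
  · intro t ht x hx
    have hct := clampIcc_of_mem hT ht
    have hlin : ∀ e, ∀ s ∈ Icc 0 T, HasDerivWithinAt (W e (t, x))
        (A s (Φ (t, x) s) (W e (t, x) s)) (Icc 0 T) s := fun e s hs => by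
      simpa only [hB, clampIcc_of_mem hT hs] using hW e (t, x) s hs
    have hWt' : ∀ e, W e (t, x) t = e := fun e => by simpa only [hct] using hWt e (t, x)
    have hΦt' : ∀ y, Φ (t, y) t = y := fun y => by simpa only [hct] using hΦt (t, y)
    exact ((hg₀.differentiable one_ne_zero).differentiableAt.hasFDerivAt).comp_hasFDerivWithinAt x
      (hasFDerivWithinAt_flow hv hS hvA hA hAK ht (Φ := fun y => Φ (t, y)) (fun y => hΦ (t, y)) hΦt'
        (fun y hy => hinv _ (hΦ (t, y)) t ht (by rwa [hΦt'])) hx (hlin (1, 0)) (hlin (0, 1))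
        (hWt' _) (hWt' _) h0)
  · intro u hu t ht
    have := eqOn_Icc_of_trajectories hv ht (hΦ (t, u t)) hu
      (by simpa only [clampIcc_of_mem hT ht] using hΦt (t, u t)) 0 h0
    exact congrArg g₀ this

/-- A function which is constant along trajectories satisfies the transport equation. -/
lemma hasDerivWithinAt_time_of_const_along {v : ℝ → E → E} {S : Set E} (hS : Convex ℝ S) {T : ℝ}
    {g : ℝ → E → ℝ} {g' : ℝ → E → E →L[ℝ] ℝ}
    (hg : ∀ t ∈ Icc 0 T, ∀ x ∈ S, HasFDerivWithinAt (g t) (g' t x) S x)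
    (hg' : ContinuousOn (fun q : ℝ × E => g' q.1 q.2) (Icc 0 T ×ˢ S))
    {u : ℝ → E} (hu : IsTrajectory v T u) (huS : ∀ s ∈ Icc 0 T, u s ∈ S) {c : ℝ}
    (hc : ∀ s ∈ Icc 0 T, g s (u s) = c) {t : ℝ} (ht : t ∈ Icc 0 T) :
    HasDerivWithinAt (fun s => g s (u t)) (-(g' t (u t) (v t (u t)))) (Icc 0 T) t := by
  have h := ((hasDerivWithinAt_sub_along_curve hS hg hg' ht (hu t ht) huS).const_sub c)
  refine h.congr_of_mem (fun s hs => ?_) ht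
  simp [hc s hs]

/-- A solution of the transport equation is constant along trajectories. -/
lemma const_along_of_transport {v : ℝ → E → E} {S : Set E} (hS : Convex ℝ S) {T : ℝ}
    {g gt : ℝ → E → ℝ} {g' : ℝ → E → E →L[ℝ] ℝ}
    (hg : ∀ t ∈ Icc 0 T, ∀ x ∈ S, HasFDerivWithinAt (g t) (g' t x) S x)
    (hg' : ContinuousOn (fun q : ℝ × E => g' q.1 q.2) (Icc 0 T ×ˢ S))
    (hgt : ∀ t ∈ Icc 0 T, ∀ x ∈ S, HasDerivWithinAt (fun s => g s x) (gt t x) (Icc 0 T) t)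
    (heq : ∀ t ∈ Icc 0 T, ∀ x ∈ S, gt t x + g' t x (v t x) = 0)
    {u : ℝ → E} (hu : IsTrajectory v T u) (huS : ∀ s ∈ Icc 0 T, u s ∈ S) :
    ∀ t ∈ Icc 0 T, g t (u t) = g 0 (u 0) := by
  rcases lt_or_ge T 0 with hT | hT
  · simp [Icc_eq_empty_of_lt hT]
  rcases hT.eq_or_lt with rfl | hT
  · simp
  have hder : ∀ t ∈ Icc 0 T, HasDerivWithinAt (fun s => g s (u s)) 0 (Icc 0 T) t := by
    intro t ht
    have h := (hgt t ht _ (huS t ht)).add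
      (hasDerivWithinAt_sub_along_curve hS hg hg' ht (hu t ht) huS)
    rw [heq t ht _ (huS t ht)] at h
    exact h.congr_of_mem (fun s _ => by simp) ht
  exact constant_of_derivWithin_zero (fun t ht => (hder t ht).differentiableWithinAt)
    fun t ht => (hder t (Ico_subset_Icc_self ht)).derivWithin
      (uniqueDiffOn_Icc hT t (Ico_subset_Icc_self ht))

/-- Extending a function differentiable on `[a, b]` affinely beyond the endpoints gives a
two-sided derivative. -/
lemma hasDerivAt_affine_extension {f f' : ℝ → ℝ} {a b : ℝ} (h : a < b) {x : ℝ} (hx : x ∈ Icc a b)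
    (hf : HasDerivWithinAt f (f' x) (Icc a b) x) :
    HasDerivAt (fun y => f (clampIcc h.le y) + (y - clampIcc h.le y) * f' (clampIcc h.le y))
      (f' x) x := by
  have hin : HasDerivWithinAt
      (fun y => f (clampIcc h.le y) + (y - clampIcc h.le y) * f' (clampIcc h.le y))
      (f' x) (Icc a b) x :=
    hf.congr_of_mem (fun y hy => by simp [clampIcc_of_mem h.le hy]) hx
  have haff : ∀ c : ℝ, HasDerivAt (fun y => f c + (y - c) * f' c) (f' c) c := fun c => by
    simpa using (((hasDerivAt_id c).sub_const c).mul_const (f' c)).const_add (f c)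
  rcases hx.1.eq_or_lt with rfl | hax
  · have hleft : HasDerivWithinAt
        (fun y => f (clampIcc h.le y) + (y - clampIcc h.le y) * f' (clampIcc h.le y))
        (f' a) (Iic a) a :=
      (haff a).hasDerivWithinAt.congr_of_mem
        (fun y hy => by simp [clampIcc, projIcc_of_le_left h.le hy]) self_mem_Iic
    refine (hleft.union hin).hasDerivAt (Filter.mem_of_superset (Iio_mem_nhds h) fun y hy => ?_)
    rcases le_total y a with hya | hya
    exacts [Or.inl hya, Or.inr ⟨hya, hy.le⟩]
  rcases hx.2.eq_or_lt with rfl | hxb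
  · have hright : HasDerivWithinAt
        (fun y => f (clampIcc h.le y) + (y - clampIcc h.le y) * f' (clampIcc h.le y))
        (f' x) (Ici x) x :=
      (haff x).hasDerivWithinAt.congr_of_mem
        (fun y hy => by simp [clampIcc, projIcc_of_right_le h.le hy]) self_mem_Ici
    refine (hin.union hright).hasDerivAt (Filter.mem_of_superset (Ioi_mem_nhds h) fun y hy => ?_)
    rcases le_total y x with hya | hya
    exacts [Or.inl ⟨hy.le, hya⟩, Or.inr hya]
  · exact hin.hasDerivAt (Icc_mem_nhds hax hxb)

lemma norm_ofColumns_le {F : Type*} [NormedAddCommGroup F] [NormedSpace ℝ F] (a b : F) :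
    ‖ofColumns a b‖ ≤ ‖a‖ + ‖b‖ := by
  refine ContinuousLinearMap.opNorm_le_bound _ (by positivity) fun h => ?_
  rw [ofColumns_apply, add_mul, mul_comm ‖a‖, mul_comm ‖b‖]
  refine (norm_add_le _ _).trans (add_le_add ?_ ?_) <;> rw [norm_smul] <;> gcongr
  exacts [norm_fst_le h, norm_snd_le h]

/-- If the first component of a Lipschitz vector field vanishes on the line `r = c`, a trajectory
which meets this line stays on it. -/
lemma fst_eq_of_fst_field_eq_zero {v : ℝ → ℝ × ℝ → ℝ × ℝ} {K : ℝ≥0}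
    (hv : ∀ s, LipschitzWith K (v s)) {c : ℝ} (hc : ∀ s θ, (v s (c, θ)).1 = 0) {T t : ℝ}
    (ht : t ∈ Icc 0 T) {u : ℝ → ℝ × ℝ} (hu : IsTrajectory v T u) (hut : (u t).1 = c) :
    ∀ s ∈ Icc 0 T, (u s).1 = c := by
  refine eqOn_Icc_of_trajectories (v := fun s y => (v s (y, (u s).2)).1) (K := K) (fun s => ?_) ht
    (f := fun s => (u s).1) (g := fun _ => c) (fun s hs => (hu s hs).fst) (fun s hs => ?_) hut
  · simpa using! LipschitzWith.prod_fst.comp ((hv s).comp (LipschitzWith.prodMk_right (u s).2))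
  · rw [hc]
    exact hasDerivWithinAt_const _ _ _

lemma fst_mem_Icc_of_trajectory {v : ℝ → ℝ × ℝ → ℝ × ℝ} {K : ℝ≥0}
    (hv : ∀ s, LipschitzWith K (v s)) {a b : ℝ} (ha : ∀ s θ, (v s (a, θ)).1 = 0)
    (hb : ∀ s θ, (v s (b, θ)).1 = 0) {T t : ℝ} (ht : t ∈ Icc 0 T) {u : ℝ → ℝ × ℝ}
    (hu : IsTrajectory v T u) (hut : (u t).1 ∈ Icc a b) {s : ℝ} (hs : s ∈ Icc 0 T) :
    (u s).1 ∈ Icc a b := by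
  have hsub : uIcc t s ⊆ Icc 0 T := uIcc_subset_Icc ht hs
  have hcont : ContinuousOn (fun x => (u x).1) (uIcc t s) := fun x hx =>
    ((hu x (hsub hx)).continuousWithinAt.mono hsub).fst
  have hivt := intermediate_value_uIcc hcont
  constructor
  · by_contra! h
    obtain ⟨x, hx, hxa⟩ := hivt (mem_uIcc.2 (Or.inr ⟨h.le, hut.1⟩))
    exact h.ne (fst_eq_of_fst_field_eq_zero hv ha (hsub hx) hu hxa s hs)
  · by_contra! h
    obtain ⟨x, hx, hxb⟩ := hivt (mem_uIcc.2 (Or.inl ⟨hut.2, h.le⟩))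
    exact h.ne' (fst_eq_of_fst_field_eq_zero hv hb (hsub hx) hu hxb s hs)

end ODE

section Strip

open scoped NNReal

variable {T R₁ R₂ : ℝ}

lemma exists_bound_of_periodic {f : ℝ → ℝ → ℝ → ℝ} (hf : ContinuousOn (u3 f) (dom3 T R₁ R₂))
    (hper : ∀ t ∈ Icc (0 : ℝ) T, ∀ r ∈ Icc R₁ R₂, ∀ θ : ℝ, f t r (θ + 2 * π) = f t r θ) :
    ∃ C : ℝ, ∀ t ∈ Icc (0 : ℝ) T, ∀ r ∈ Icc R₁ R₂, ∀ θ : ℝ, ‖f t r θ‖ ≤ C := by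
  have hsub : Icc (0 : ℝ) T ×ˢ (Icc R₁ R₂ ×ˢ Icc 0 (2 * π)) ⊆ dom3 T R₁ R₂ :=
    prod_mono_right (prod_mono_right (subset_univ _))
  obtain ⟨C, hC⟩ := (isCompact_Icc.prod (isCompact_Icc.prod isCompact_Icc)).exists_bound_of_continuousOn
    (hf.mono hsub)
  refine ⟨C, fun t ht r hr θ => ?_⟩
  obtain ⟨θ', hθ', h⟩ := Function.Periodic.exists_mem_Ico₀ (f := f t r) (hper t ht r hr)
    two_pi_pos θ
  rw [h]
  exact hC (t, r, θ') ⟨ht, hr, Ico_subset_Icc_self hθ'⟩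

/-- The extension of a function on `[0, T] × [R₁, R₂] × ℝ` that is constant in the first two
variables beyond the endpoints. -/
def clampExt (hT : 0 ≤ T) (hR : R₁ ≤ R₂) (f : ℝ → ℝ → ℝ → ℝ) (t : ℝ) (x : ℝ × ℝ) : ℝ :=
  f (clampIcc hT t) (clampIcc hR x.1) x.2

lemma continuous_clampExt (hT : 0 ≤ T) (hR : R₁ ≤ R₂) {f : ℝ → ℝ → ℝ → ℝ}
    (hf : ContinuousOn (u3 f) (dom3 T R₁ R₂)) :
    Continuous fun q : ℝ × ℝ × ℝ => clampExt hT hR f q.1 q.2 := by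
  refine hf.comp_continuous (f := fun q : ℝ × ℝ × ℝ => (clampIcc hT q.1, clampIcc hR q.2.1, q.2.2))
    ?_ fun q => ⟨clampIcc_mem hT _, clampIcc_mem hR _, mem_univ _⟩
  exact ((continuous_clampIcc hT).comp continuous_fst).prodMk
    (((continuous_clampIcc hR).comp (continuous_fst.comp continuous_snd)).prodMk
      (continuous_snd.comp continuous_snd))

lemma hasFDerivWithinAt_clampExt (hT : 0 ≤ T) (hR : R₁ ≤ R₂) {f fr fθ : ℝ → ℝ → ℝ → ℝ}
    (hr : ∀ t ∈ Icc 0 T, ∀ r ∈ Icc R₁ R₂, ∀ θ,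
      HasDerivWithinAt (fun r' => f t r' θ) (fr t r θ) (Icc R₁ R₂) r)
    (hθ : ∀ t ∈ Icc 0 T, ∀ r ∈ Icc R₁ R₂, ∀ θ, HasDerivAt (fun θ' => f t r θ') (fθ t r θ) θ)
    (hfr : ContinuousOn (u3 fr) (dom3 T R₁ R₂)) (t : ℝ) {x : ℝ × ℝ}
    (hx : x ∈ Icc R₁ R₂ ×ˢ (univ : Set ℝ)) :
    HasFDerivWithinAt (clampExt hT hR f t)
      (ofColumns (clampExt hT hR fr t x) (clampExt hT hR fθ t x)) (Icc R₁ R₂ ×ˢ univ) x := by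
  have hct := clampIcc_mem hT t
  have h := hasFDerivWithinAt_strip_of_partial (convex_Icc R₁ R₂) (hr _ hct) (hθ _ hct)
    (hfr.comp (Continuous.prodMk_right (clampIcc hT t)).continuousOn fun q hq => ⟨hct, hq⟩) hx.1
  simp only [clampExt, clampIcc_of_mem hR hx.1]
  exact h.congr (fun y hy => by simp only [clampExt, clampIcc_of_mem hR hy.1])
    (by simp only [clampExt, clampIcc_of_mem hR hx.1])

lemma lipschitzWith_clampIcc {a b : ℝ} (h : a ≤ b) : LipschitzWith 1 (clampIcc h) := by
  simpa using! (LipschitzWith.subtype_val (Icc a b)).comp (LipschitzWith.projIcc h)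

lemma clampExt_clamp (hT : 0 ≤ T) (hR : R₁ ≤ R₂) (f : ℝ → ℝ → ℝ → ℝ) (t : ℝ) (x : ℝ × ℝ) :
    clampExt hT hR f t (clampIcc hR x.1, x.2) = clampExt hT hR f t x := by
  simp only [clampExt, clampIcc_of_mem hR (clampIcc_mem hR x.1)]

lemma clampExt_of_mem (hT : 0 ≤ T) (hR : R₁ ≤ R₂) (f : ℝ → ℝ → ℝ → ℝ) {t r : ℝ}
    (ht : t ∈ Icc 0 T) (hr : r ∈ Icc R₁ R₂) (θ : ℝ) : clampExt hT hR f t (r, θ) = f t r θ := by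
  simp only [clampExt, clampIcc_of_mem hR hr, clampIcc_of_mem hT ht]

/-- Well-posedness of the transport equation `∂ₜρ + a ∂ᵣρ + b ∂_θρ = 0` on a strip, for a `C¹`
velocity field `(a, b)` periodic in `θ` and tangent to the boundary. -/
theorem exists_unique_transport_strip (hT : 0 < T) (hR : R₁ < R₂)
    {a b ar aθ br bθ : ℝ → ℝ → ℝ → ℝ}
    (ha : ContinuousOn (u3 a) (dom3 T R₁ R₂)) (hb : ContinuousOn (u3 b) (dom3 T R₁ R₂))
    (har : ContinuousOn (u3 ar) (dom3 T R₁ R₂)) (haθ : ContinuousOn (u3 aθ) (dom3 T R₁ R₂))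
    (hbr : ContinuousOn (u3 br) (dom3 T R₁ R₂)) (hbθ : ContinuousOn (u3 bθ) (dom3 T R₁ R₂))
    (hper : ∀ f ∈ ({a, b, ar, aθ, br, bθ} : Set (ℝ → ℝ → ℝ → ℝ)),
      ∀ t ∈ Icc 0 T, ∀ r ∈ Icc R₁ R₂, ∀ θ, f t r (θ + 2 * π) = f t r θ)
    (hdar : ∀ t ∈ Icc 0 T, ∀ r ∈ Icc R₁ R₂, ∀ θ,
      HasDerivWithinAt (fun r' => a t r' θ) (ar t r θ) (Icc R₁ R₂) r)
    (hdaθ : ∀ t ∈ Icc 0 T, ∀ r ∈ Icc R₁ R₂, ∀ θ, HasDerivAt (fun θ' => a t r θ') (aθ t r θ) θ)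
    (hdbr : ∀ t ∈ Icc 0 T, ∀ r ∈ Icc R₁ R₂, ∀ θ,
      HasDerivWithinAt (fun r' => b t r' θ) (br t r θ) (Icc R₁ R₂) r)
    (hdbθ : ∀ t ∈ Icc 0 T, ∀ r ∈ Icc R₁ R₂, ∀ θ, HasDerivAt (fun θ' => b t r θ') (bθ t r θ) θ)
    (hbdry : ∀ t ∈ Icc 0 T, ∀ θ, a t R₁ θ = 0 ∧ a t R₂ θ = 0)
    {ρ₀ : ℝ → ℝ → ℝ} (hρ₀ : ContDiff ℝ 1 (fun q : ℝ × ℝ => ρ₀ q.1 q.2))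
    (hρ₀per : ∀ r ∈ Icc R₁ R₂, ∀ θ, ρ₀ r (θ + 2 * π) = ρ₀ r θ) :
    ∃ ρ : ℝ → ℝ → ℝ → ℝ,
      (C1On3 T R₁ R₂ ρ ∧
        (∀ t ∈ Icc 0 T, ∀ r ∈ Icc R₁ R₂, ∀ θ, ρ t r (θ + 2 * π) = ρ t r θ) ∧
        (∀ t ∈ Icc 0 T, ∀ r ∈ Icc R₁ R₂, ∀ θ,
          dt3 ρ t r θ + a t r θ * dr3 ρ t r θ + b t r θ * dq3 ρ t r θ = 0) ∧
        (∀ r ∈ Icc R₁ R₂, ∀ θ, ρ 0 r θ = ρ₀ r θ)) ∧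
      ∀ ρ' : ℝ → ℝ → ℝ → ℝ, C1On3 T R₁ R₂ ρ' →
        (∀ t ∈ Icc 0 T, ∀ r ∈ Icc R₁ R₂, ∀ θ,
          dt3 ρ' t r θ + a t r θ * dr3 ρ' t r θ + b t r θ * dq3 ρ' t r θ = 0) →
        (∀ r ∈ Icc R₁ R₂, ∀ θ, ρ' 0 r θ = ρ₀ r θ) →
        ∀ t ∈ Icc 0 T, ∀ r ∈ Icc R₁ R₂, ∀ θ, ρ' t r θ = ρ t r θ := by
  set S : Set (ℝ × ℝ) := Icc R₁ R₂ ×ˢ univ with hSdef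
  have hS : Convex ℝ S := (convex_Icc _ _).prod convex_univ
  have h0 : (0 : ℝ) ∈ Icc 0 T := ⟨le_rfl, hT.le⟩
  set E := clampExt hT.le hR.le with hE
  set v : ℝ → ℝ × ℝ → ℝ × ℝ := fun t x => (E a t x, E b t x) with hvdef
  set A : ℝ → ℝ × ℝ → ℝ × ℝ →L[ℝ] ℝ × ℝ := fun t x =>
    (ofColumns (E ar t x) (E aθ t x)).prod (ofColumns (E br t x) (E bθ t x)) with hAdef
  have hvc : Continuous (Function.uncurry v) :=
    (continuous_clampExt hT.le hR.le ha).prodMk (continuous_clampExt hT.le hR.le hb)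
  have hA : Continuous fun q : ℝ × ℝ × ℝ => A q.1 q.2 := by
    have h1 := continuous_ofColumns.comp
      ((continuous_clampExt hT.le hR.le har).prodMk (continuous_clampExt hT.le hR.le haθ))
    have h2 := continuous_ofColumns.comp
      ((continuous_clampExt hT.le hR.le hbr).prodMk (continuous_clampExt hT.le hR.le hbθ))
    exact (ContinuousLinearMap.prodₗᵢ ℝ).continuous.comp (h1.prodMk h2)
  have hvA : ∀ t, ∀ x ∈ S, HasFDerivWithinAt (v t) (A t x) S x := fun t x hx =>
    (hasFDerivWithinAt_clampExt hT.le hR.le hdar hdaθ har t hx).prodMk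
      (hasFDerivWithinAt_clampExt hT.le hR.le hdbr hdbθ hbr t hx)
  obtain ⟨K, hAK⟩ : ∃ K : ℝ≥0, ∀ t x, ‖A t x‖ ≤ K := by
    obtain ⟨C₁, h₁⟩ := exists_bound_of_periodic har (hper ar (by simp))
    obtain ⟨C₂, h₂⟩ := exists_bound_of_periodic haθ (hper aθ (by simp))
    obtain ⟨C₃, h₃⟩ := exists_bound_of_periodic hbr (hper br (by simp))
    obtain ⟨C₄, h₄⟩ := exists_bound_of_periodic hbθ (hper bθ (by simp))
    refine ⟨Real.toNNReal (max (C₁ + C₂) (C₃ + C₄)), fun t x => ?_⟩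
    refine le_trans ?_ (Real.le_coe_toNNReal _)
    have ht := clampIcc_mem hT.le t
    have hx := clampIcc_mem hR.le x.1
    rw [hAdef, ContinuousLinearMap.opNorm_prod]
    exact max_le_max
      ((norm_ofColumns_le _ _).trans (add_le_add (h₁ _ ht _ hx _) (h₂ _ ht _ hx _)))
      ((norm_ofColumns_le _ _).trans (add_le_add (h₃ _ ht _ hx _) (h₄ _ ht _ hx _)))
  have hv : ∀ t, LipschitzWith K (v t) := fun t => by
    have h1 : LipschitzOnWith K (v t) S := hS.lipschitzOnWith_of_nnnorm_hasFDerivWithin_le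
      (hvA t) fun x _ => hAK t x
    have h2 : LipschitzWith 1 fun x : ℝ × ℝ => (clampIcc hR.le x.1, x.2) := by
      simpa using! ((lipschitzWith_clampIcc hR.le).comp LipschitzWith.prod_fst).prodMk
        LipschitzWith.prod_snd
    have h3 := h1.comp (h2.lipschitzOnWith (s := univ))
      fun x _ => ⟨clampIcc_mem hR.le x.1, mem_univ _⟩
    rw [mul_one, lipschitzOnWith_univ] at h3
    have h4 : v t ∘ (fun x : ℝ × ℝ => (clampIcc hR.le x.1, x.2)) = v t := by
      funext x
      simp only [hvdef, hE, Function.comp_apply, clampExt_clamp]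
    rwa [h4] at h3
  have hinv : ∀ u, IsTrajectory v T u → ∀ t ∈ Icc 0 T, u t ∈ S → ∀ s ∈ Icc 0 T, u s ∈ S := by
    intro u hu t ht hut s hs
    refine ⟨fst_mem_Icc_of_trajectory hv (fun s θ => ?_) (fun s θ => ?_) ht hu hut.1 hs, mem_univ _⟩
    · simpa only [hvdef, hE, clampExt, clampIcc_of_mem hR.le (left_mem_Icc.2 hR.le)] using
        (hbdry _ (clampIcc_mem hT.le s) θ).1
    · simpa only [hvdef, hE, clampExt, clampIcc_of_mem hR.le (right_mem_Icc.2 hR.le)] using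
        (hbdry _ (clampIcc_mem hT.le s) θ).2
  obtain ⟨g, g', hgc, hg'c, hg, hchar⟩ := exists_transported hv hvc hS hvA hA hAK hT.le hinv hρ₀
  have htraj : ∀ t ∈ Icc 0 T, ∀ x, ∃ u, u t = x ∧ IsTrajectory v T u :=
    fun t ht x => exists_trajectory_Icc hv hvc ht x
  have hgt : ∀ t ∈ Icc 0 T, ∀ x ∈ S,
      HasDerivWithinAt (fun s => g s x) (-(g' t x (v t x))) (Icc 0 T) t := by
    intro t ht x hx
    obtain ⟨u, rfl, hu⟩ := htraj t ht x
    exact hasDerivWithinAt_time_of_const_along hS hg hg'c.continuousOn hu (hinv u hu t ht hx)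
      (hchar u hu) ht
  have hshift : ∀ f ∈ ({a, b, ar, aθ, br, bθ} : Set (ℝ → ℝ → ℝ → ℝ)), ∀ t x,
      E f t (x + (0, 2 * π)) = E f t x := fun f hf t x => by
    simpa [hE, clampExt] using hper f hf _ (clampIcc_mem hT.le t) _ (clampIcc_mem hR.le x.1) x.2
  have hgper : ∀ t ∈ Icc 0 T, ∀ x ∈ S, g t (x + (0, 2 * π)) = g t x := by
    intro t ht x hx
    obtain ⟨u, rfl, hu⟩ := htraj t ht x
    have hu' : IsTrajectory v T fun s => u s + (0, 2 * π) := fun s hs => by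
      have hvs : v s (u s + (0, 2 * π)) = v s (u s) := by
        simp only [hvdef, hshift a (by simp), hshift b (by simp)]
      rw [hvs]
      exact (hu s hs).add_const _
    rw [hchar _ hu' t ht, hchar _ hu t ht]
    simpa using hρ₀per _ (hinv u hu t ht hx 0 h0).1 (u 0).2
  set gt : ℝ → ℝ × ℝ → ℝ := fun t x => -(g' t x (v t x)) with hgtdef
  set ρ : ℝ → ℝ → ℝ → ℝ := fun t r θ =>
    g (clampIcc hT.le t) (clampIcc hR.le r, θ)
      + (r - clampIcc hR.le r) * g' (clampIcc hT.le t) (clampIcc hR.le r, θ) (1, 0)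
      + (t - clampIcc hT.le t) * gt (clampIcc hT.le t) (clampIcc hR.le r, θ) with hρdef
  have hρg : ∀ t ∈ Icc 0 T, ∀ r ∈ Icc R₁ R₂, ∀ θ, ρ t r θ = g t (r, θ) := fun t ht r hr θ => by
    simp [hρdef, clampIcc_of_mem hT.le ht, clampIcc_of_mem hR.le hr]
  have hρt : ∀ t ∈ Icc 0 T, ∀ r ∈ Icc R₁ R₂, ∀ θ,
      HasDerivAt (fun t' => ρ t' r θ) (gt t (r, θ)) t := fun t ht r hr θ => by
    simpa [hρdef, clampIcc_of_mem hR.le hr] using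
      hasDerivAt_affine_extension hT (f' := fun s => gt s (r, θ)) ht (hgt t ht (r, θ) ⟨hr, mem_univ _⟩)
  have hρr : ∀ t ∈ Icc 0 T, ∀ r ∈ Icc R₁ R₂, ∀ θ,
      HasDerivAt (fun r' => ρ t r' θ) (g' t (r, θ) (1, 0)) r := fun t ht r hr θ => by
    have hline : HasDerivWithinAt (fun r' : ℝ => (r', θ)) (1, 0) (Icc R₁ R₂) r :=
      ((hasDerivAt_id r).prodMk (hasDerivAt_const r θ)).hasDerivWithinAt
    have h := (hg t ht (r, θ) ⟨hr, mem_univ _⟩).comp_hasDerivWithinAt r hline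
      (t := S) fun r' hr' => ⟨hr', mem_univ _⟩
    simpa [hρdef, clampIcc_of_mem hT.le ht] using
      hasDerivAt_affine_extension hR (f' := fun r => g' t (r, θ) (1, 0)) hr h
  have hρθ : ∀ t ∈ Icc 0 T, ∀ r ∈ Icc R₁ R₂, ∀ θ,
      HasDerivAt (fun θ' => ρ t r θ') (g' t (r, θ) (0, 1)) θ := fun t ht r hr θ => by
    have hline : HasDerivWithinAt (fun θ' : ℝ => (r, θ')) (0, 1) univ θ :=
      ((hasDerivAt_const θ r).prodMk (hasDerivAt_id θ)).hasDerivWithinAt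
    have h := (hg t ht (r, θ) ⟨hr, mem_univ _⟩).comp_hasDerivWithinAt θ hline
      (t := S) fun θ' _ => ⟨hr, mem_univ _⟩
    simp only [hρg t ht r hr]
    exact hasDerivWithinAt_univ.1 h
  refine ⟨ρ, ⟨⟨fun t ht r hr θ => ⟨(hρt t ht r hr θ).differentiableAt,
    (hρr t ht r hr θ).differentiableAt, (hρθ t ht r hr θ).differentiableAt⟩, ?_, ?_, ?_, ?_⟩,
    ?_, ?_, ?_⟩, ?_⟩
  · exact hgc.continuousOn.congr fun q hq => hρg _ hq.1 _ hq.2.1 _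
  · have hc : Continuous fun q : ℝ × ℝ × ℝ => gt q.1 q.2 := (hg'c.clm_apply hvc).neg
    exact hc.continuousOn.congr fun q hq => (hρt _ hq.1 _ hq.2.1 _).deriv
  · exact (hg'c.clm_apply continuous_const).continuousOn.congr
      fun q hq => (hρr _ hq.1 _ hq.2.1 _).deriv
  · exact (hg'c.clm_apply continuous_const).continuousOn.congr
      fun q hq => (hρθ _ hq.1 _ hq.2.1 _).deriv
  · intro t ht r hr θ
    rw [hρg t ht r hr, hρg t ht r hr]
    simpa using hgper t ht (r, θ) ⟨hr, mem_univ _⟩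
  · intro t ht r hr θ
    rw [dt3, dr3, dq3, (hρt t ht r hr θ).deriv, (hρr t ht r hr θ).deriv, (hρθ t ht r hr θ).deriv]
    have hvv : v t (r, θ) = a t r θ • ((1, 0) : ℝ × ℝ) + b t r θ • ((0, 1) : ℝ × ℝ) := by
      simp [hvdef, hE, clampExt_of_mem hT.le hR.le _ ht hr]
    simp only [hgtdef, hvv, map_add, map_smul, smul_eq_mul]
    ring
  · intro r hr θ
    obtain ⟨u, hu0, hu⟩ := htraj 0 h0 (r, θ)
    have := hchar u hu 0 h0
    rw [hu0] at this
    rw [hρg 0 h0 r hr, this]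
  · intro ρ' hC1 hpde hinit t ht r hr θ
    obtain ⟨hd, -, -, hcr, hcθ⟩ := hC1
    obtain ⟨u, hut, hu⟩ := htraj t ht (r, θ)
    have huS := hinv u hu t ht (by rw [hut]; exact ⟨hr, mem_univ _⟩)
    have hconst := const_along_of_transport (g := fun t x => ρ' t x.1 x.2)
      (gt := fun t x => dt3 ρ' t x.1 x.2)
      (g' := fun t x => ofColumns (dr3 ρ' t x.1 x.2) (dq3 ρ' t x.1 x.2)) hS
      (fun t ht x hx => hasFDerivWithinAt_strip_of_partial (convex_Icc R₁ R₂)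
        (fr := dr3 ρ' t) (fθ := dq3 ρ' t)
        (fun r hr θ => (hd t ht r hr θ).2.1.hasDerivAt.hasDerivWithinAt)
        (fun r hr θ => (hd t ht r hr θ).2.2.hasDerivAt)
        (hcr.comp (Continuous.prodMk_right t).continuousOn fun q hq => ⟨ht, hq⟩) hx.1)
      (continuous_ofColumns.comp_continuousOn (hcr.prodMk hcθ))
      (fun t ht x hx => (hd t ht x.1 hx.1 x.2).1.hasDerivAt.hasDerivWithinAt)
      (fun t ht x hx => by
        have h := hpde t ht x.1 hx.1 x.2
        have hvv : v t x = (a t x.1 x.2, b t x.1 x.2) := by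
          simp only [hvdef, hE]
          rw [← clampExt_of_mem hT.le hR.le a ht hx.1, ← clampExt_of_mem hT.le hR.le b ht hx.1]
        rw [hvv, ofColumns_apply, smul_eq_mul, smul_eq_mul, ← add_assoc]
        exact h)
      hu huS t ht
    simp only [hut] at hconst
    have hg0 := hchar u hu t ht
    rw [hut] at hg0
    rw [hconst, hρg t ht r hr, hg0]
    exact hinit _ (huS 0 h0).1 _

end Strip

lemma deriv_eq_of_eqOn_Icc {a b x : ℝ} (hab : a < b) (hx : x ∈ Icc a b) {f g : ℝ → ℝ}
    (hfg : EqOn f g (Icc a b)) (hf : DifferentiableAt ℝ f x) (hg : DifferentiableAt ℝ g x) :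
    deriv f x = deriv g x := by
  have hu := uniqueDiffOn_Icc hab x hx
  rw [← hf.derivWithin hu, ← hg.derivWithin hu]
  exact derivWithin_congr hfg (hfg hx)

lemma dr3_periodic {T R₁ R₂ : ℝ} (hR : R₁ < R₂) {f : ℝ → ℝ → ℝ → ℝ}
    (hper : ∀ t ∈ Icc (0 : ℝ) T, ∀ r ∈ Icc R₁ R₂, ∀ θ, f t r (θ + 2 * π) = f t r θ)
    (hd : ∀ t ∈ Icc (0 : ℝ) T, ∀ r ∈ Icc R₁ R₂, ∀ θ, DifferentiableAt ℝ (fun r' => f t r' θ) r) :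
    ∀ t ∈ Icc (0 : ℝ) T, ∀ r ∈ Icc R₁ R₂, ∀ θ, dr3 f t r (θ + 2 * π) = dr3 f t r θ :=
  fun t ht r hr θ => deriv_eq_of_eqOn_Icc hR hr (fun r' hr' => hper t ht r' hr' θ)
    (hd t ht r hr _) (hd t ht r hr _)

lemma dq3_periodic {T R₁ R₂ : ℝ} {f : ℝ → ℝ → ℝ → ℝ}
    (hper : ∀ t ∈ Icc (0 : ℝ) T, ∀ r ∈ Icc R₁ R₂, ∀ θ, f t r (θ + 2 * π) = f t r θ) :
    ∀ t ∈ Icc (0 : ℝ) T, ∀ r ∈ Icc R₁ R₂, ∀ θ, dq3 f t r (θ + 2 * π) = dq3 f t r θ := by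
  intro t ht r hr θ
  have h := deriv_comp_add_const (fun θ' => f t r θ') (2 * π) θ
  simp only [hper t ht r hr] at h
  exact h.symm

/-- Existence and uniqueness for the transport equation along a divergence-free
velocity field tangent to the boundary (Lemma 3.2 of the paper). -/
theorem statement19 (R₁ R₂ μ α T : ℝ) (hR₁ : 0 < R₁) (hR₁₂ : R₁ < R₂) (hμ : 0 < μ)
    (hT : 0 < T) (vr vθ : ℝ → ℝ → ℝ → ℝ)
    (hvr_cont : ContinuousOn (u3 vr) (dom3 T R₁ R₂))
    (hvθ_cont : ContinuousOn (u3 vθ) (dom3 T R₁ R₂))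
    (hdiff : ∀ t ∈ Icc (0:ℝ) T, ∀ r ∈ Icc R₁ R₂, ∀ θ : ℝ,
      DifferentiableAt ℝ (fun r' => vr t r' θ) r ∧
      DifferentiableAt ℝ (fun θ' => vr t r θ') θ ∧
      DifferentiableAt ℝ (fun r' => vθ t r' θ) r ∧
      DifferentiableAt ℝ (fun θ' => vθ t r θ') θ)
    (hgrad_cont :
      ContinuousOn (u3 (dr3 vr)) (dom3 T R₁ R₂) ∧
      ContinuousOn (u3 (dq3 vr)) (dom3 T R₁ R₂) ∧
      ContinuousOn (u3 (dr3 vθ)) (dom3 T R₁ R₂) ∧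
      ContinuousOn (u3 (dq3 vθ)) (dom3 T R₁ R₂))
    (hper : ∀ t ∈ Icc (0:ℝ) T, ∀ r ∈ Icc R₁ R₂, ∀ θ : ℝ,
      vr t r (θ + 2 * π) = vr t r θ ∧ vθ t r (θ + 2 * π) = vθ t r θ)
    (hdiv : ∀ t ∈ Icc (0:ℝ) T, ∀ r ∈ Icc R₁ R₂, ∀ θ : ℝ,
      deriv (fun x => x * vr t x θ) r + dq3 vθ t r θ = 0)
    (hbc : ∀ t ∈ Icc (0:ℝ) T, ∀ θ : ℝ,
      vr t R₁ θ = 0 ∧ vr t R₂ θ = 0 ∧ vθ t R₂ θ = 0 ∧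
      dr3 vθ t R₁ θ = (1 / R₁ - α / μ) * vθ t R₁ θ)
    (ρ₀ : ℝ → ℝ → ℝ) (hρ₀ : ContDiff ℝ 1 (fun q : ℝ × ℝ => ρ₀ q.1 q.2))
    (hρ₀per : ∀ r ∈ Icc R₁ R₂, ∀ θ : ℝ, ρ₀ r (θ + 2 * π) = ρ₀ r θ) :
    ∃ ρ : ℝ → ℝ → ℝ → ℝ,
      (C1On3 T R₁ R₂ ρ ∧
        (∀ t ∈ Icc (0:ℝ) T, ∀ r ∈ Icc R₁ R₂, ∀ θ : ℝ, ρ t r (θ + 2 * π) = ρ t r θ) ∧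
        (∀ t ∈ Icc (0:ℝ) T, ∀ r ∈ Icc R₁ R₂, ∀ θ : ℝ,
          dt3 ρ t r θ + vr t r θ * dr3 ρ t r θ + (vθ t r θ / r) * dq3 ρ t r θ = 0) ∧
        (∀ r ∈ Icc R₁ R₂, ∀ θ : ℝ, ρ 0 r θ = ρ₀ r θ)) ∧
      ∀ ρ' : ℝ → ℝ → ℝ → ℝ,
        (C1On3 T R₁ R₂ ρ' ∧
          (∀ t ∈ Icc (0:ℝ) T, ∀ r ∈ Icc R₁ R₂, ∀ θ : ℝ, ρ' t r (θ + 2 * π) = ρ' t r θ) ∧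
          (∀ t ∈ Icc (0:ℝ) T, ∀ r ∈ Icc R₁ R₂, ∀ θ : ℝ,
            dt3 ρ' t r θ + vr t r θ * dr3 ρ' t r θ + (vθ t r θ / r) * dq3 ρ' t r θ = 0) ∧
          (∀ r ∈ Icc R₁ R₂, ∀ θ : ℝ, ρ' 0 r θ = ρ₀ r θ)) →
        ∀ t ∈ Icc (0:ℝ) T, ∀ r ∈ Icc R₁ R₂, ∀ θ : ℝ, ρ' t r θ = ρ t r θ := by
  have hpos : ∀ r ∈ Icc R₁ R₂, r ≠ 0 := fun r hr => (hR₁.trans_le hr.1).ne'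
  have hrc : ContinuousOn (fun q : ℝ × ℝ × ℝ => q.2.1) (dom3 T R₁ R₂) := by fun_prop
  obtain ⟨hrr, hrq, hθr, hθq⟩ := hgrad_cont
  have hper_r := fun t ht r hr θ => (hper t ht r hr θ).1
  have hper_θ := fun t ht r hr θ => (hper t ht r hr θ).2
  obtain ⟨ρ, hρ, huniq⟩ := exists_unique_transport_strip hT hR₁₂ (a := vr)
    (b := fun t r θ => vθ t r θ / r) (ar := dr3 vr) (aθ := dq3 vr)
    (br := fun t r θ => (dr3 vθ t r θ * r - vθ t r θ * 1) / r ^ 2)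
    (bθ := fun t r θ => dq3 vθ t r θ / r)
    hvr_cont (hvθ_cont.div hrc fun q hq => hpos _ hq.2.1) hrr hrq
    ((((hθr.mul hrc).sub hvθ_cont).div (hrc.fun_pow 2)
      fun q hq => pow_ne_zero 2 (hpos _ hq.2.1)).congr fun q _ => by simp [u3])
    (hθq.div hrc fun q hq => hpos _ hq.2.1)
    (by
      have h1 := dr3_periodic hR₁₂ hper_r fun t ht r hr θ => (hdiff t ht r hr θ).1
      have h2 := dr3_periodic hR₁₂ hper_θ fun t ht r hr θ => (hdiff t ht r hr θ).2.2.1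
      have h3 := dq3_periodic hper_r
      have h4 := dq3_periodic hper_θ
      rintro f (rfl | rfl | rfl | rfl | rfl | rfl) t ht r hr θ
      · exact hper_r t ht r hr θ
      · simp only [hper_θ t ht r hr]
      · exact h1 t ht r hr θ
      · exact h3 t ht r hr θ
      · simp only [hper_θ t ht r hr, h2 t ht r hr]
      · simp only [h4 t ht r hr])
    (fun t ht r hr θ => (hdiff t ht r hr θ).1.hasDerivAt.hasDerivWithinAt)
    (fun t ht r hr θ => (hdiff t ht r hr θ).2.1.hasDerivAt)
    (fun t ht r hr θ => ((hdiff t ht r hr θ).2.2.1.hasDerivAt.div (hasDerivAt_id r)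
      (hpos r hr)).hasDerivWithinAt)
    (fun t ht r hr θ => (hdiff t ht r hr θ).2.2.2.hasDerivAt.div_const r)
    (fun t ht θ => ⟨(hbc t ht θ).1, (hbc t ht θ).2.1⟩) hρ₀ hρ₀per
  exact ⟨ρ, hρ, fun ρ' h => huniq ρ' h.1 h.2.2.1 h.2.2.2⟩

end
end
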